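/- arXiv:2203.10312 — 2 statements merged into one kernel-verified Lean document; each statement's English description precedes it below -/
import Mathlib

section
/- Let N ≥ 2 and s ∈ (0,1). The function 𝒬_s defined by 𝒬_s(x) = x_1^{s−1} for x_1 > 0 and 𝒬_s(x) = 0 for x_1 ≤ 0 is s-harmonic in the upper half space: for every x ∈ ℝ^N_+, the principal value limit lim_{ε→0^+} c_{N,s} ∫_{{z : ε<|z|<1/ε}} (𝒬_s(x) − 𝒬_s(x+z)) |z|^{−N−2s} dz exists and equals 0. -/
open MeasureTheory Real Filter Set Topology

noncomputable section

/-- The normalizing constant `c_{N,s}` of the fractional Laplacian. -/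
def cns (N : ℕ) (s : ℝ) : ℝ :=
  (2 : ℝ) ^ (2 * s) * Real.pi ^ (-(N : ℝ) / 2) * s *
    Real.Gamma (((N : ℝ) + 2 * s) / 2) / Real.Gamma (1 - s)

/-- The annulus `{z : ε < |z| < 1/ε}` in `ℝ^N`. -/
def annulus (N : ℕ) (ε : ℝ) : Set (EuclideanSpace ℝ (Fin N)) :=
  {z | ε < ‖z‖ ∧ ‖z‖ < 1 / ε}

/-- The truncated fractional-Laplacian integral
`∫_{ε<|z|<1/ε} (u(x) - u(x+z)) |z|^{-N-2s} dz` (without the normalizing constant). -/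
def pvInt (N : ℕ) (s : ℝ) (u : EuclideanSpace ℝ (Fin N) → ℝ)
    (x : EuclideanSpace ℝ (Fin N)) (ε : ℝ) : ℝ :=
  ∫ z in annulus N ε, (u x - u (x + z)) / ‖z‖ ^ ((N : ℝ) + 2 * s)

/-- `u` is `s`-harmonic at `x` in the principal value sense:
`lim_{ε→0⁺} c_{N,s} ∫_{ε<|z|<1/ε} (u(x) - u(x+z)) |z|^{-N-2s} dz = 0`. -/
def SHarmonicAt (N : ℕ) (s : ℝ) (u : EuclideanSpace ℝ (Fin N) → ℝ)
    (x : EuclideanSpace ℝ (Fin N)) : Prop :=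
  Tendsto (fun ε : ℝ => cns N s * pvInt N s u x ε) (𝓝[>] (0 : ℝ)) (𝓝 0)

/-- The function `𝒬_s(x) = x₁^{s-1}` on `ℝ^N_+`, zero for `x₁ ≤ 0`. -/
def Qs (N : ℕ) [NeZero N] (s : ℝ) (x : EuclideanSpace ℝ (Fin N)) : ℝ :=
  if 0 < x 0 then (x 0) ^ (s - 1) else 0

/-- The truncated power `t ↦ t₊^{s-1}`. -/
def truncPow (s t : ℝ) : ℝ := if 0 < t then t ^ (s - 1) else 0

lemma truncPow_of_pos {s t : ℝ} (ht : 0 < t) : truncPow s t = t ^ (s - 1) := if_pos ht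

lemma truncPow_of_nonpos {s t : ℝ} (ht : t ≤ 0) : truncPow s t = 0 := if_neg ht.not_gt

lemma truncPow_nonneg (s t : ℝ) : 0 ≤ truncPow s t := by
  unfold truncPow; split_ifs <;> positivity

lemma truncPow_mul {s c : ℝ} (hc : 0 < c) (t : ℝ) :
    truncPow s (c * t) = c ^ (s - 1) * truncPow s t := by
  rcases lt_or_ge 0 t with ht | ht
  · rw [truncPow_of_pos ht, truncPow_of_pos (mul_pos hc ht), Real.mul_rpow hc.le ht.le]
  · rw [truncPow_of_nonpos ht, truncPow_of_nonpos (mul_nonpos_of_nonneg_of_nonpos hc.le ht),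
      mul_zero]

lemma measurable_truncPow (s : ℝ) : Measurable (truncPow s) :=
  Measurable.ite measurableSet_Ioi (measurable_id.pow_const _) measurable_const

lemma tendsto_rpow_mul_one_add_rpow {s : ℝ} (hs : 0 < s) :
    Tendsto (fun t : ℝ => -(t ^ (-2 * s) * (1 + t) ^ s) / s) atTop (𝓝 0) := by
  have h : Tendsto (fun t : ℝ => t ^ (-2 * s) * (1 + t) ^ s) atTop (𝓝 0) := by
    have h1 : Tendsto (fun t : ℝ => (2 : ℝ) ^ s * t ^ (-s)) atTop (𝓝 0) := by
      simpa using (tendsto_rpow_neg_atTop hs).const_mul ((2 : ℝ) ^ s)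
    refine squeeze_zero' ?_ ?_ h1
    · filter_upwards [eventually_ge_atTop 0] with t ht
      positivity
    · filter_upwards [eventually_ge_atTop 1] with t ht
      have h0 : (0 : ℝ) < t := by linarith
      calc t ^ (-2 * s) * (1 + t) ^ s ≤ t ^ (-2 * s) * (2 * t) ^ s := by
            gcongr; linarith
        _ = (2 : ℝ) ^ s * t ^ (-s) := by
            rw [Real.mul_rpow (by norm_num) h0.le, mul_left_comm, ← Real.rpow_add h0]
            ring_nf
  simpa using h.neg.div_const s

lemma hasDerivAt_rpow_mul_one_add_rpow {s t : ℝ} (hs : 0 < s) (ht : 0 < t) :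
    HasDerivAt (fun t : ℝ => -(t ^ (-2 * s) * (1 + t) ^ s) / s)
      ((1 + t) ^ (s - 1) * t ^ (-1 - 2 * s) + (1 + t) ^ s * t ^ (-1 - 2 * s)) t := by
  have h1 : (0 : ℝ) < 1 + t := by linarith
  have ha := Real.hasDerivAt_rpow_const (x := t) (p := -2 * s) (Or.inl ht.ne')
  have hb := ((hasDerivAt_id t).const_add 1).rpow_const (p := s) (Or.inl h1.ne')
  refine ((ha.mul hb).neg.div_const s).congr_deriv ?_
  have e1 : t ^ (-2 * s) = t * t ^ (-1 - 2 * s) := by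
    rw [← Real.rpow_one_add' ht.le] <;> [ring_nf; nlinarith]
  have e2 : (1 + t) ^ s = (1 + t) * (1 + t) ^ (s - 1) := by
    rw [← Real.rpow_one_add' h1.le] <;> [ring_nf; nlinarith]
  have e3 : t ^ (-2 * s - 1) = t ^ (-1 - 2 * s) := by ring_nf
  simp only [id, e1, e2, e3]
  field_simp
  ring

lemma image_div_one_add_Ioi {δ : ℝ} (hδ : 0 < δ) :
    (fun t : ℝ => t / (1 + t)) '' Ioi δ = Ioo (δ / (1 + δ)) 1 := by
  ext y
  simp only [mem_image, mem_Ioi, mem_Ioo]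
  constructor
  · rintro ⟨t, ht, rfl⟩
    have h1 : 0 < 1 + t := by linarith
    have h2 : 0 < 1 + δ := by linarith
    rw [div_lt_div_iff₀ h2 h1, div_lt_one h1]
    constructor <;> nlinarith
  · rintro ⟨h1, h2⟩
    have h3 : 0 < 1 - y := by linarith
    have h4 : 0 < 1 + δ := by linarith
    rw [div_lt_iff₀ h4] at h1
    refine ⟨y / (1 - y), ?_, ?_⟩
    · rw [lt_div_iff₀ h3]; nlinarith
    · field_simp; ring

lemma hasDerivAt_div_one_add {t : ℝ} (ht : 0 < t) :
    HasDerivAt (fun t : ℝ => t / (1 + t)) (1 / (1 + t) ^ 2) t := by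
  have h1 : 1 + t ≠ 0 := by linarith
  refine ((hasDerivAt_id t).div ((hasDerivAt_id t).const_add 1) h1).congr_deriv ?_
  simp

lemma injOn_div_one_add {δ : ℝ} (hδ : 0 < δ) : InjOn (fun t : ℝ => t / (1 + t)) (Ioi δ) := by
  intro a ha b hb hab
  have h1 : 1 + a ≠ 0 := by have := mem_Ioi.1 ha; linarith
  have h2 : 1 + b ≠ 0 := by have := mem_Ioi.1 hb; linarith
  simp only at hab
  rw [div_eq_div_iff h1 h2] at hab
  linarith

lemma abs_deriv_smul_rpow_div_one_add {s t : ℝ} (ht : 0 < t) :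
    |1 / (1 + t) ^ 2| • ((1 - t / (1 + t)) ^ (s - 1) * (t / (1 + t)) ^ (-1 - 2 * s)) =
      (1 + t) ^ s * t ^ (-1 - 2 * s) := by
  have h1 : (0 : ℝ) < 1 + t := by linarith
  have e : 1 - t / (1 + t) = (1 + t)⁻¹ := by field_simp; ring
  rw [abs_of_pos (by positivity), e, Real.inv_rpow h1.le, Real.div_rpow ht.le h1.le,
    ← Real.rpow_neg h1.le, smul_eq_mul, one_div, ← Real.rpow_natCast (1 + t) 2,
    ← Real.rpow_neg h1.le, div_eq_mul_inv, ← Real.rpow_neg h1.le (-1 - 2 * s)]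
  rw [show (1 + t) ^ (-((2 : ℕ) : ℝ)) * ((1 + t) ^ (-(s - 1)) *
      (t ^ (-1 - 2 * s) * (1 + t) ^ (-(-1 - 2 * s)))) =
      ((1 + t) ^ (-((2 : ℕ) : ℝ)) * (1 + t) ^ (-(s - 1)) * (1 + t) ^ (-(-1 - 2 * s))) *
      t ^ (-1 - 2 * s) by ring, ← Real.rpow_add h1, ← Real.rpow_add h1]
  congr 2
  push_cast
  ring

lemma integrableOn_one_add_rpow_add {s δ : ℝ} (hs : 0 < s) (hδ : 0 < δ) :
    IntegrableOn (fun t : ℝ => (1 + t) ^ (s - 1) * t ^ (-1 - 2 * s) +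
      (1 + t) ^ s * t ^ (-1 - 2 * s)) (Ioi δ) := by
  refine integrableOn_Ioi_deriv_of_nonneg'
    (fun t ht => hasDerivAt_rpow_mul_one_add_rpow hs (hδ.trans_le ht)) (fun t ht => ?_)
    (tendsto_rpow_mul_one_add_rpow hs)
  have : 0 < t := hδ.trans ht
  positivity

lemma integrableOn_one_add_rpow_sub_one {s δ : ℝ} (hs : 0 < s) (hδ : 0 < δ) :
    IntegrableOn (fun t : ℝ => (1 + t) ^ (s - 1) * t ^ (-1 - 2 * s)) (Ioi δ) := by
  refine (integrableOn_one_add_rpow_add hs hδ).mono' (by fun_prop) ?_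
  filter_upwards [ae_restrict_mem measurableSet_Ioi] with t ht
  have : 0 < t := hδ.trans ht
  rw [Real.norm_of_nonneg (by positivity)]
  exact le_add_of_nonneg_right (by positivity)

lemma integrableOn_one_add_rpow {s δ : ℝ} (hs : 0 < s) (hδ : 0 < δ) :
    IntegrableOn (fun t : ℝ => (1 + t) ^ s * t ^ (-1 - 2 * s)) (Ioi δ) := by
  refine (integrableOn_one_add_rpow_add hs hδ).mono' (by fun_prop) ?_
  filter_upwards [ae_restrict_mem measurableSet_Ioi] with t ht
  have : 0 < t := hδ.trans ht
  rw [Real.norm_of_nonneg (by positivity)]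
  exact le_add_of_nonneg_left (by positivity)

lemma truncPow_one_sub_mul_eq_indicator (s : ℝ) :
    (fun t : ℝ => truncPow s (1 - t) * t ^ (-1 - 2 * s)) =
      (Iio 1).indicator (fun t : ℝ => (1 - t) ^ (s - 1) * t ^ (-1 - 2 * s)) := by
  ext t
  rcases lt_or_ge t 1 with h | h
  · rw [indicator_of_mem (mem_Iio.2 h), truncPow_of_pos (by linarith)]
  · rw [indicator_of_notMem (by simpa using h), truncPow_of_nonpos (by linarith), zero_mul]

lemma integrableOn_truncPow_one_sub_div {s δ : ℝ} (hs : 0 < s) (hδ : 0 < δ) :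
    IntegrableOn (fun t : ℝ => truncPow s (1 - t) * t ^ (-1 - 2 * s)) (Ioi (δ / (1 + δ))) := by
  rw [truncPow_one_sub_mul_eq_indicator, integrableOn_indicator_iff measurableSet_Iio,
    inter_comm, Ioi_inter_Iio, ← image_div_one_add_Ioi hδ,
    integrableOn_image_iff_integrableOn_abs_deriv_smul measurableSet_Ioi
      (fun t ht => (hasDerivAt_div_one_add (hδ.trans ht)).hasDerivWithinAt) (injOn_div_one_add hδ)]
  exact (integrableOn_one_add_rpow hs hδ).congr_fun
    (fun t ht => (abs_deriv_smul_rpow_div_one_add (hδ.trans ht)).symm) measurableSet_Ioi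

lemma integral_truncPow_one_sub_div {s δ : ℝ} (hδ : 0 < δ) :
    ∫ t in Ioi (δ / (1 + δ)), truncPow s (1 - t) * t ^ (-1 - 2 * s) =
      ∫ t in Ioi δ, (1 + t) ^ s * t ^ (-1 - 2 * s) := by
  rw [truncPow_one_sub_mul_eq_indicator, setIntegral_indicator measurableSet_Iio,
    Ioi_inter_Iio, ← image_div_one_add_Ioi hδ,
    integral_image_eq_integral_abs_deriv_smul measurableSet_Ioi
      (fun t ht => (hasDerivAt_div_one_add (hδ.trans ht)).hasDerivWithinAt) (injOn_div_one_add hδ)]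
  exact setIntegral_congr_fun measurableSet_Ioi
    (fun t ht => abs_deriv_smul_rpow_div_one_add (hδ.trans ht))

lemma div_one_add_lt {δ : ℝ} (hδ : 0 < δ) : δ / (1 + δ) < δ :=
  div_lt_self hδ (by linarith)

lemma integrableOn_truncPow_one_sub {s δ : ℝ} (hs : 0 < s) (hδ : 0 < δ) :
    IntegrableOn (fun t : ℝ => truncPow s (1 - t) * t ^ (-1 - 2 * s)) (Ioi δ) :=
  (integrableOn_truncPow_one_sub_div hs hδ).mono_set (Ioi_subset_Ioi (div_one_add_lt hδ).le)

/-- The symmetrized integrand of the one-dimensional fractional Laplacian of `t₊^{s-1}` at `1`. -/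
def symmKernel (s t : ℝ) : ℝ :=
  (2 - truncPow s (1 + t) - truncPow s (1 - t)) * t ^ (-1 - 2 * s)

lemma eqOn_symmKernel {s δ : ℝ} (hδ : 0 < δ) :
    EqOn (symmKernel s) (fun t => 2 * t ^ (-1 - 2 * s) - (1 + t) ^ (s - 1) * t ^ (-1 - 2 * s)
      - truncPow s (1 - t) * t ^ (-1 - 2 * s)) (Ioi δ) := by
  intro t ht
  have : 0 < t := hδ.trans ht
  simp only [symmKernel]
  rw [truncPow_of_pos (t := 1 + t) (by linarith)]
  ring

lemma integrableOn_symmKernel {s δ : ℝ} (hs : 0 < s) (hδ : 0 < δ) :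
    IntegrableOn (symmKernel s) (Ioi δ) := by
  refine IntegrableOn.congr_fun ?_ (eqOn_symmKernel hδ).symm measurableSet_Ioi
  exact (((integrableOn_Ioi_rpow_of_lt (by linarith) hδ).const_mul 2).sub
    (integrableOn_one_add_rpow_sub_one hs hδ)).sub (integrableOn_truncPow_one_sub hs hδ)

lemma integral_Ioi_symmKernel {s δ : ℝ} (hs : 0 < s) (hδ : 0 < δ) :
    ∫ t in Ioi δ, symmKernel s t = δ ^ (-2 * s) * ((1 - (1 + δ) ^ s) / s) +
      ∫ t in Ioc (δ / (1 + δ)) δ, truncPow s (1 - t) * t ^ (-1 - 2 * s) := by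
  have h2 : ∫ t in Ioi δ, (t : ℝ) ^ (-1 - 2 * s) = δ ^ (-2 * s) / (2 * s) := by
    rw [integral_Ioi_rpow_of_lt (by linarith) hδ]
    rw [show -1 - 2 * s + 1 = -2 * s by ring]
    field_simp
  have hsum : (∫ t in Ioi δ, (1 + t) ^ (s - 1) * t ^ (-1 - 2 * s)) +
      ∫ t in Ioi δ, (1 + t) ^ s * t ^ (-1 - 2 * s) = δ ^ (-2 * s) * (1 + δ) ^ s / s := by
    rw [← integral_add (integrableOn_one_add_rpow_sub_one hs hδ)
      (integrableOn_one_add_rpow hs hδ), integral_Ioi_of_hasDerivAt_of_nonneg'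
      (fun t ht => hasDerivAt_rpow_mul_one_add_rpow hs (hδ.trans_le ht)) (fun t ht => ?_)
      (tendsto_rpow_mul_one_add_rpow hs)]
    · ring
    · have : 0 < t := hδ.trans ht
      positivity
  have hsplit : ∫ t in Ioi (δ / (1 + δ)), truncPow s (1 - t) * t ^ (-1 - 2 * s) =
      (∫ t in Ioc (δ / (1 + δ)) δ, truncPow s (1 - t) * t ^ (-1 - 2 * s)) +
      ∫ t in Ioi δ, truncPow s (1 - t) * t ^ (-1 - 2 * s) := by
    rw [← Ioc_union_Ioi_eq_Ioi (div_one_add_lt hδ).le]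
    refine setIntegral_union (Ioc_disjoint_Ioi le_rfl) measurableSet_Ioi ?_
      (integrableOn_truncPow_one_sub hs hδ)
    exact (integrableOn_truncPow_one_sub_div hs hδ).mono_set Ioc_subset_Ioi_self
  rw [integral_truncPow_one_sub_div hδ] at hsplit
  have hA : IntegrableOn (fun t : ℝ => 2 * t ^ (-1 - 2 * s)) (Ioi δ) :=
    (integrableOn_Ioi_rpow_of_lt (by linarith) hδ).const_mul 2
  have hAB : IntegrableOn
      (fun t : ℝ => 2 * t ^ (-1 - 2 * s) - (1 + t) ^ (s - 1) * t ^ (-1 - 2 * s)) (Ioi δ) :=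
    hA.sub (integrableOn_one_add_rpow_sub_one hs hδ)
  rw [setIntegral_congr_fun measurableSet_Ioi (eqOn_symmKernel hδ),
    integral_sub hAB (integrableOn_truncPow_one_sub hs hδ),
    integral_sub hA (integrableOn_one_add_rpow_sub_one hs hδ), integral_const_mul, h2]
  have : δ ^ (-2 * s) * ((1 - (1 + δ) ^ s) / s) =
    2 * (δ ^ (-2 * s) / (2 * s)) - δ ^ (-2 * s) * (1 + δ) ^ s / s := by field_simp
  linarith

lemma integral_Ioc_rpow {s δ : ℝ} (hs : 0 < s) (hδ : 0 < δ) :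
    ∫ t in Ioc (δ / (1 + δ)) δ, (t : ℝ) ^ (-1 - 2 * s) =
      δ ^ (-2 * s) * ((((1 + δ) ^ s) ^ 2 - 1) / (2 * s)) := by
  have h1 : 0 < 1 + δ := by linarith
  have hγ : 0 < δ / (1 + δ) := by positivity
  have hne : -1 - 2 * s ≠ -1 := by intro h; linarith
  rw [← intervalIntegral.integral_of_le (div_one_add_lt hδ).le, integral_rpow
    (Or.inr ⟨hne, notMem_uIcc_of_lt hγ hδ⟩)]
  rw [show -1 - 2 * s + 1 = -2 * s by ring, Real.div_rpow hδ.le h1.le,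
    ← Real.rpow_natCast, ← Real.rpow_mul h1.le, div_eq_mul_inv (δ ^ (-2 * s)),
    ← Real.rpow_neg h1.le, show -(-2 * s) = s * ((2 : ℕ) : ℝ) by push_cast; ring]
  field_simp
  ring

lemma integral_Ioi_symmKernel_mem {s δ : ℝ} (hs : s ∈ Ioo (0 : ℝ) 1) (hδ : 0 < δ)
    (hδ' : δ ≤ 1 / 2) :
    0 ≤ ∫ t in Ioi δ, symmKernel s t ∧ ∫ t in Ioi δ, symmKernel s t ≤ 3 * δ ^ (2 - 2 * s) := by
  obtain ⟨hs0, hs1⟩ := hs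
  have h1 : 0 < 1 + δ := by linarith
  have hγ : 0 < δ / (1 + δ) := by positivity
  rw [integral_Ioi_symmKernel hs0 hδ]
  have hint : IntegrableOn (fun t : ℝ => t ^ (-1 - 2 * s)) (Ioc (δ / (1 + δ)) δ) :=
    (integrableOn_Ioi_rpow_of_lt (by linarith) hγ).mono_set Ioc_subset_Ioi_self
  have hint' : IntegrableOn (fun t : ℝ => truncPow s (1 - t) * t ^ (-1 - 2 * s))
      (Ioc (δ / (1 + δ)) δ) :=
    (integrableOn_truncPow_one_sub_div hs0 hδ).mono_set Ioc_subset_Ioi_self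
  have hlow := setIntegral_mono_on hint hint' measurableSet_Ioc (fun t ht => by
    have : 0 < t := hγ.trans ht.1
    rw [truncPow_of_pos (by linarith [ht.2])]
    refine le_mul_of_one_le_left (by positivity) ?_
    exact Real.one_le_rpow_of_pos_of_le_one_of_nonpos (by linarith [ht.2]) (by linarith)
      (by linarith))
  have hup := setIntegral_mono_on hint' (hint.const_mul (1 + 2 * δ)) measurableSet_Ioc
    (fun t ht => by
    have : 0 < t := hγ.trans ht.1
    have h1t : 0 < 1 - t := by linarith [ht.2]
    rw [truncPow_of_pos h1t]
    refine mul_le_mul_of_nonneg_right ?_ (by positivity)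
    calc (1 - t) ^ (s - 1) ≤ (1 - t) ^ (-1 : ℝ) :=
          Real.rpow_le_rpow_of_exponent_ge h1t (by linarith) (by linarith)
      _ = 1 / (1 - t) := by rw [Real.rpow_neg_one, one_div]
      _ ≤ 1 + 2 * δ := by
          rw [div_le_iff₀ h1t]; nlinarith [ht.2])
  rw [integral_const_mul] at hup
  rw [integral_Ioc_rpow hs0 hδ] at hlow hup
  set y := (1 + δ) ^ s with hy
  set D := δ ^ (-2 * s) with hD
  have hDpos : 0 < D := by positivity
  have hy1 : 1 ≤ y := Real.one_le_rpow (by linarith) hs0.le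
  have hy2 : y ≤ 1 + s * δ := rpow_one_add_le_one_add_mul_self (by linarith) hs0.le hs1.le
  obtain ⟨v, hv⟩ : ∃ v, v = (y - 1) / s := ⟨_, rfl⟩
  have hv0 : 0 ≤ v := by rw [hv]; exact div_nonneg (by linarith) hs0.le
  have hv1 : v ≤ δ := by rw [hv, div_le_iff₀ hs0]; linarith
  have e1 : (1 - y) / s = -v := by rw [hv]; ring
  have e2 : (y ^ 2 - 1) / (2 * s) = v * ((y + 1) / 2) := by rw [hv]; field_simp; ring
  have e3 : δ ^ (2 - 2 * s) = D * δ ^ 2 := by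
    rw [hD, ← Real.rpow_natCast, ← Real.rpow_add hδ]; push_cast; ring_nf
  rw [e1]
  rw [e2] at hlow hup
  rw [e3]
  have hyδ : y ≤ 1 + δ := by nlinarith
  constructor
  · have : 0 ≤ D * (v * ((y + 1) / 2 - 1)) := by
      have : 0 ≤ (y + 1) / 2 - 1 := by linarith
      positivity
    linarith
  · have h3 : v * ((1 + 2 * δ) * ((y + 1) / 2) - 1) ≤ 3 * δ ^ 2 := by
      have ha : (1 + 2 * δ) * ((y + 1) / 2) - 1 ≤ 3 * δ := by nlinarith
      calc _ ≤ v * (3 * δ) := by gcongr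
        _ ≤ δ * (3 * δ) := by gcongr
        _ = _ := by ring
    have := mul_le_mul_of_nonneg_left h3 hDpos.le
    linarith

lemma tendsto_integral_Ioi_symmKernel_zero {s : ℝ} (hs : s ∈ Ioo (0 : ℝ) 1) :
    Tendsto (fun δ => ∫ t in Ioi δ, symmKernel s t) (𝓝[>] 0) (𝓝 0) := by
  have h : Tendsto (fun δ : ℝ => 3 * δ ^ (2 - 2 * s)) (𝓝[>] 0) (𝓝 0) := by
    have h1 := (Real.continuousAt_rpow_const 0 (2 - 2 * s) (Or.inr (by linarith [hs.2]))).tendsto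
    rw [Real.zero_rpow (by linarith [hs.2])] at h1
    simpa using (h1.mono_left nhdsWithin_le_nhds).const_mul 3
  have hmem : ∀ᶠ δ : ℝ in 𝓝[>] 0, 0 < δ ∧ δ ≤ 1 / 2 := by
    filter_upwards [Ioc_mem_nhdsGT (show (0 : ℝ) < 1 / 2 by norm_num)] with δ hδ using hδ
  exact squeeze_zero' (hmem.mono fun δ hδ => (integral_Ioi_symmKernel_mem hs hδ.1 hδ.2).1)
    (hmem.mono fun δ hδ => (integral_Ioi_symmKernel_mem hs hδ.1 hδ.2).2) h

lemma integral_Ioi_symmKernel_sub {s a b : ℝ} (hs : 0 < s) (ha : 0 < a) (hab : a ≤ b) :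
    ∫ t in Ioc a b, symmKernel s t =
      (∫ t in Ioi a, symmKernel s t) - ∫ t in Ioi b, symmKernel s t := by
  rw [← Ioc_union_Ioi_eq_Ioi hab, setIntegral_union (Ioc_disjoint_Ioi le_rfl) measurableSet_Ioi
    ((integrableOn_symmKernel hs ha).mono_set Ioc_subset_Ioi_self)
    (integrableOn_symmKernel hs (ha.trans_le hab)), add_sub_cancel_right]

lemma tendsto_integral_Ioi_symmKernel_atTop {s : ℝ} (hs : 0 < s) :
    Tendsto (fun δ => ∫ t in Ioi δ, symmKernel s t) atTop (𝓝 0) := by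
  have h := intervalIntegral_tendsto_integral_Ioi 1 (integrableOn_symmKernel hs one_pos) tendsto_id
  have h' := h.const_sub (∫ t in Ioi 1, symmKernel s t)
  rw [sub_self] at h'
  refine h'.congr' ?_
  filter_upwards [eventually_ge_atTop 1] with b hb
  rw [id, intervalIntegral.integral_of_le hb, integral_Ioi_symmKernel_sub hs one_pos hb]
  ring

lemma exists_abs_integral_Ioi_symmKernel_le {s : ℝ} (hs : s ∈ Ioo (0 : ℝ) 1) :
    ∃ C, ∀ δ, 0 < δ → |∫ t in Ioi δ, symmKernel s t| ≤ C := by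
  refine ⟨max 3 (∫ t in Ioi (1 / 2), |symmKernel s t|), fun δ hδ => ?_⟩
  rcases le_total δ (1 / 2) with h | h
  · obtain ⟨h1, h2⟩ := integral_Ioi_symmKernel_mem hs hδ h
    rw [abs_of_nonneg h1]
    refine le_max_of_le_left (h2.trans ?_)
    have : δ ^ (2 - 2 * s) ≤ 1 :=
      Real.rpow_le_one hδ.le (by linarith) (by linarith [hs.2])
    linarith
  · refine le_max_of_le_right ((abs_integral_le_integral_abs).trans ?_)
    refine setIntegral_mono_set (integrableOn_symmKernel hs.1 (by norm_num)).abs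
      (Eventually.of_forall fun t => abs_nonneg _) ?_
    exact (Ioi_subset_Ioi h).eventuallyLE

/-- Polar coordinates: the radial integrals of an integrable function are integrable on the sphere
and integrate to the full integral. -/
lemma integrable_and_integral_toSphere {E : Type*} [NormedAddCommGroup E] [NormedSpace ℝ E]
    [MeasurableSpace E] [BorelSpace E] [FiniteDimensional ℝ E] [Nontrivial E] (μ : Measure E)
    [μ.IsAddHaarMeasure] {f : E → ℝ} (hf : Integrable f μ) :
    Integrable (fun θ : Metric.sphere (0 : E) 1 =>
      ∫ r in Ioi (0 : ℝ), r ^ (Module.finrank ℝ E - 1) * f (r • (θ : E))) μ.toSphere ∧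
    ∫ z, f z ∂μ = ∫ θ : Metric.sphere (0 : E) 1,
      (∫ r in Ioi (0 : ℝ), r ^ (Module.finrank ℝ E - 1) * f (r • (θ : E))) ∂μ.toSphere := by
  set n := Module.finrank ℝ E - 1
  set g : Metric.sphere (0 : E) 1 × Ioi (0 : ℝ) → ℝ := fun p => f ((p.2 : ℝ) • (p.1 : E)) with hg
  have hmp := μ.measurePreserving_homeomorphUnitSphereProd
  have hcomp : g ∘ homeomorphUnitSphereProd E = fun z : ({0}ᶜ : Set E) => f z := by
    ext z
    have : ‖(z : E)‖ ≠ 0 := norm_ne_zero_iff.2 z.2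
    simp [hg, smul_smul, this]
  have hgint : Integrable g (μ.toSphere.prod (Measure.volumeIoiPow n)) := by
    rw [← hmp.integrable_comp_emb (Homeomorph.measurableEmbedding _), hcomp]
    have := hf.integrableOn (s := ({0}ᶜ : Set E))
    rwa [integrableOn_iff_comap_subtypeVal (measurableSet_singleton _).compl] at this
  have hinner : ∀ θ : Metric.sphere (0 : E) 1,
      ∫ r : Ioi (0 : ℝ), g (θ, r) ∂Measure.volumeIoiPow n =
        ∫ r in Ioi (0 : ℝ), r ^ n * f (r • (θ : E)) := by
    intro θ
    simp only [Measure.volumeIoiPow, ENNReal.ofReal]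
    rw [integral_withDensity_eq_integral_smul
      ((measurable_subtype_coe.pow_const _).real_toNNReal),
      integral_subtype_comap measurableSet_Ioi
        fun a : ℝ ↦ Real.toNNReal (a ^ n) • f (a • (θ : E))]
    refine setIntegral_congr_fun measurableSet_Ioi fun r hr => ?_
    simp only [NNReal.smul_def, Real.coe_toNNReal _ (pow_nonneg (mem_Ioi.1 hr).le _), smul_eq_mul]
  constructor
  · simpa only [hinner] using hgint.integral_prod_left
  · calc ∫ z, f z ∂μ = ∫ z : ({0}ᶜ : Set E), f z ∂(μ.comap (↑)) := by
          rw [integral_subtype_comap (measurableSet_singleton _).compl f,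
            restrict_compl_singleton]
      _ = ∫ p, g p ∂(μ.toSphere.prod (Measure.volumeIoiPow n)) := by
          rw [← hmp.integral_comp (Homeomorph.measurableEmbedding _) g]
          exact congrArg (fun F => ∫ z, F z ∂(μ.comap (↑))) hcomp.symm
      _ = _ := by
          rw [integral_prod _ hgint]
          exact integral_congr_ae (Eventually.of_forall hinner)

lemma integrableOn_truncPow {s : ℝ} (hs : 0 < s) (a b : ℝ) :
    IntegrableOn (truncPow s) (Icc a b) := by
  have h : truncPow s = (Ioi 0).indicator (fun t : ℝ => t ^ (s - 1)) := by
    ext t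
    simp [truncPow, indicator]
  rw [h]
  refine IntegrableOn.indicator ?_ measurableSet_Ioi
  rcases le_or_gt a b with hab | hab
  · rw [integrableOn_Icc_iff_integrableOn_Ioc, ← intervalIntegrable_iff_integrableOn_Ioc_of_le hab]
    exact intervalIntegral.intervalIntegrable_rpow' (by linarith)
  · simp [hab]

lemma integrableOn_comp_coord_ball {N : ℕ} [NeZero N] {g : ℝ → ℝ} (R : ℝ)
    (hg : IntegrableOn g (Icc (-R) R)) (hgm : Measurable g) :
    IntegrableOn (fun z : EuclideanSpace ℝ (Fin N) => g (z 0)) (Metric.ball 0 R) := by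
  set F : Fin N → ℝ → ℝ := fun i => (Icc (-R) R).indicator (if i = 0 then g else 1) with hF
  have hFi : ∀ i, Integrable (F i) := by
    intro i
    rw [hF, integrable_indicator_iff measurableSet_Icc]
    split_ifs with h
    · exact hg
    · exact integrableOn_const (by simp)
  have hprod := Integrable.fintype_prod hFi
  have hcomp := (PiLp.volume_preserving_ofLp (Fin N)).integrable_comp_of_integrable hprod
  refine hcomp.norm.integrableOn.mono'
    (hgm.comp (by fun_prop)).aestronglyMeasurable ?_
  filter_upwards [ae_restrict_mem Metric.isOpen_ball.measurableSet] with z hz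
  have hz' : ‖z‖ < R := by simpa using hz
  have hFz : ∀ i, F i (z.ofLp i) = if i = 0 then g (z.ofLp i) else 1 := by
    intro i
    have : z.ofLp i ∈ Icc (-R) R := abs_le.1 ((PiLp.norm_apply_le z i).trans hz'.le)
    simp only [hF, indicator_of_mem this]
    split_ifs <;> rfl
  simp [hFz]

lemma measurableSet_annulus (N : ℕ) (ε : ℝ) : MeasurableSet (annulus N ε) :=
  (measurableSet_lt measurable_const measurable_norm).inter
    (measurableSet_lt measurable_norm measurable_const)

lemma annulus_subset_ball (N : ℕ) (ε : ℝ) : annulus N ε ⊆ Metric.ball 0 (1 / ε) := by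
  intro z hz
  simpa using hz.2

lemma measurable_Qs (N : ℕ) [NeZero N] (s : ℝ) : Measurable (Qs N s) :=
  (measurable_truncPow s).comp (by fun_prop : Measurable fun z : EuclideanSpace ℝ (Fin N) => z 0)

lemma Qs_eq_truncPow (N : ℕ) [NeZero N] (s : ℝ) (x : EuclideanSpace ℝ (Fin N)) :
    Qs N s x = truncPow s (x 0) := rfl

lemma integrableOn_annulus_Qs (N : ℕ) [NeZero N] {s : ℝ} (hs : 0 < s)
    (x : EuclideanSpace ℝ (Fin N)) {ε : ℝ} (hε : 0 < ε) :
    IntegrableOn (fun z => (Qs N s x - Qs N s (x + z)) / ‖z‖ ^ ((N : ℝ) + 2 * s))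
      (annulus N ε) := by
  have hg : IntegrableOn (fun t => truncPow s (x 0 + t)) (Icc (-(1 / ε)) (1 / ε)) := by
    have h := integrableOn_truncPow hs (x 0 + -(1 / ε)) (x 0 + 1 / ε)
    rw [← image_const_add_Icc, (measurePreserving_add_left volume (x 0)).integrableOn_image
      (measurableEmbedding_addLeft _)] at h
    exact h
  have hQ : IntegrableOn (fun z => Qs N s (x + z)) (annulus N ε) :=
    (integrableOn_comp_coord_ball (N := N) (1 / ε) hg
      ((measurable_truncPow s).comp (by fun_prop))).mono_set (annulus_subset_ball N ε)
  have hconst : IntegrableOn (fun _ => Qs N s x) (annulus N ε) :=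
    integrableOn_const
      ((measure_mono (annulus_subset_ball N ε)).trans_lt Metric.isBounded_ball.measure_lt_top).ne
  refine ((hconst.sub hQ).norm.const_mul ((ε ^ ((N : ℝ) + 2 * s))⁻¹)).mono' ?_ ?_
  · have := (measurable_Qs N s).comp (measurable_const_add x)
    exact ((measurable_const.sub this).div (measurable_norm.pow_const _)).aestronglyMeasurable
  · filter_upwards [ae_restrict_mem (measurableSet_annulus N ε)] with z hz
    have h1 : ε ^ ((N : ℝ) + 2 * s) ≤ ‖z‖ ^ ((N : ℝ) + 2 * s) :=
      Real.rpow_le_rpow hε.le hz.1.le (by positivity)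
    have h2 : 0 < ε ^ ((N : ℝ) + 2 * s) := by positivity
    rw [norm_div, Real.norm_of_nonneg (h2.le.trans h1), div_eq_inv_mul]
    exact mul_le_mul_of_nonneg_right (inv_anti₀ h2 h1) (norm_nonneg _)

/-- The symmetrized truncated integrand of the fractional Laplacian of `Qs`. -/
def symmIntegrand (N : ℕ) [NeZero N] (s : ℝ) (x : EuclideanSpace ℝ (Fin N)) (ε : ℝ) :
    EuclideanSpace ℝ (Fin N) → ℝ :=
  (annulus N ε).indicator fun z =>
    (2 * Qs N s x - Qs N s (x + z) - Qs N s (x - z)) / ‖z‖ ^ ((N : ℝ) + 2 * s)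

lemma integrable_symmIntegrand_and_integral (N : ℕ) [NeZero N] {s : ℝ} (hs : 0 < s)
    (x : EuclideanSpace ℝ (Fin N)) {ε : ℝ} (hε : 0 < ε) :
    Integrable (symmIntegrand N s x ε) ∧
      ∫ z, symmIntegrand N s x ε z = 2 * pvInt N s (Qs N s) x ε := by
  set f := (annulus N ε).indicator
    (fun z => (Qs N s x - Qs N s (x + z)) / ‖z‖ ^ ((N : ℝ) + 2 * s)) with hf
  have hfint : Integrable f :=
    (integrable_indicator_iff (measurableSet_annulus N ε)).2 (integrableOn_annulus_Qs N hs x hε)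
  have heq : symmIntegrand N s x ε = fun z => f z + f (-z) := by
    ext z
    have hmem : -z ∈ annulus N ε ↔ z ∈ annulus N ε := by simp [annulus]
    by_cases hz : z ∈ annulus N ε
    · rw [symmIntegrand, hf, indicator_of_mem hz, indicator_of_mem hz,
        indicator_of_mem (hmem.2 hz), norm_neg, ← sub_eq_add_neg]
      ring
    · rw [symmIntegrand, hf, indicator_of_notMem hz, indicator_of_notMem hz,
        indicator_of_notMem (mt hmem.1 hz), add_zero]
  rw [heq]
  refine ⟨hfint.add hfint.comp_neg, ?_⟩
  rw [integral_add hfint hfint.comp_neg, integral_neg_eq_self f, hf,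
    integral_indicator (measurableSet_annulus N ε), pvInt]
  ring

/-- The limit profile of the radial integrals of `symmIntegrand`. -/
def radialProfile (s ε b : ℝ) : ℝ :=
  b ^ (2 * s) * ((∫ t in Ioi (b * ε), symmKernel s t) - ∫ t in Ioi (b * (1 / ε)), symmKernel s t)

lemma integral_Ioc_eq_radialProfile {s b ε : ℝ} (hs : 0 < s) (hb : 0 ≤ b) (hε : 0 < ε)
    (hε1 : ε ≤ 1) :
    ∫ r in Ioc ε (1 / ε),
      (2 - truncPow s (1 + b * r) - truncPow s (1 - b * r)) * r ^ (-1 - 2 * s) =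
      radialProfile s ε b := by
  have hle : ε ≤ 1 / ε := by rw [le_div_iff₀ hε]; nlinarith
  rcases hb.eq_or_lt with rfl | hb
  · rw [radialProfile, Real.zero_rpow (by linarith), zero_mul]
    simp only [zero_mul, add_zero, sub_zero, truncPow_of_pos one_pos, Real.one_rpow]
    norm_num
  · have h1 : ∀ r ∈ Ioc ε (1 / ε),
        (2 - truncPow s (1 + b * r) - truncPow s (1 - b * r)) * r ^ (-1 - 2 * s) =
        b ^ (1 + 2 * s) * symmKernel s (b * r) := by
      intro r hr
      have hr0 : 0 < r := hε.trans hr.1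
      rw [symmKernel, Real.mul_rpow hb.le hr0.le]
      have : b ^ (1 + 2 * s) * b ^ (-1 - 2 * s) = 1 := by
        rw [← Real.rpow_add hb, show 1 + 2 * s + (-1 - 2 * s) = 0 by ring, Real.rpow_zero]
      linear_combination (-(2 - truncPow s (1 + b * r) - truncPow s (1 - b * r)) *
        r ^ (-1 - 2 * s)) * this
    rw [setIntegral_congr_fun measurableSet_Ioc h1, integral_const_mul,
      ← intervalIntegral.integral_of_le hle, intervalIntegral.integral_comp_mul_left _ hb.ne',
      intervalIntegral.integral_of_le (by gcongr), radialProfile,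
      integral_Ioi_symmKernel_sub hs (by positivity) (by gcongr), smul_eq_mul, ← mul_assoc]
    congr 1
    rw [add_comm, Real.rpow_add hb, Real.rpow_one]
    field_simp

lemma integral_Ioi_symmIntegrand (N : ℕ) [NeZero N] {s : ℝ} (hs : 0 < s)
    (x : EuclideanSpace ℝ (Fin N)) (hx : 0 < x 0) {ε : ℝ} (hε : 0 < ε) (hε1 : ε ≤ 1)
    (θ : Metric.sphere (0 : EuclideanSpace ℝ (Fin N)) 1) :
    ∫ r in Ioi (0 : ℝ), r ^ (Module.finrank ℝ (EuclideanSpace ℝ (Fin N)) - 1) *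
        symmIntegrand N s x ε (r • (θ : EuclideanSpace ℝ (Fin N))) =
      (x 0) ^ (s - 1) * radialProfile s ε (|(θ : EuclideanSpace ℝ (Fin N)) 0| / x 0) := by
  set a := (θ : EuclideanSpace ℝ (Fin N)) 0 with ha
  have hN : N ≠ 0 := NeZero.ne N
  have hθ : ‖(θ : EuclideanSpace ℝ (Fin N))‖ = 1 := by simp
  have hpoint : EqOn (fun r : ℝ => r ^ (Module.finrank ℝ (EuclideanSpace ℝ (Fin N)) - 1) *
        symmIntegrand N s x ε (r • (θ : EuclideanSpace ℝ (Fin N))))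
      ((Ioo ε (1 / ε)).indicator fun r => (x 0) ^ (s - 1) *
        ((2 - truncPow s (1 + |a| / x 0 * r) - truncPow s (1 - |a| / x 0 * r)) *
          r ^ (-1 - 2 * s))) (Ioi 0) := by
    intro r hr
    have hr0 : 0 < r := hr
    have hnorm : ‖r • (θ : EuclideanSpace ℝ (Fin N))‖ = r := by
      rw [norm_smul, hθ, mul_one, Real.norm_of_nonneg hr0.le]
    have hmem : r • (θ : EuclideanSpace ℝ (Fin N)) ∈ annulus N ε ↔ r ∈ Ioo ε (1 / ε) := by
      simp only [annulus, mem_ofPred_eq, hnorm, mem_Ioo]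
    simp only [symmIntegrand, finrank_euclideanSpace_fin]
    by_cases h : r ∈ Ioo ε (1 / ε)
    · rw [indicator_of_mem h, indicator_of_mem (hmem.2 h), hnorm]
      simp only [Qs_eq_truncPow, PiLp.add_apply, PiLp.sub_apply, PiLp.smul_apply, smul_eq_mul,
        ← ha]
      have hsymm : truncPow s (x 0 + r * a) + truncPow s (x 0 - r * a) =
          (x 0) ^ (s - 1) *
            (truncPow s (1 + |a| / x 0 * r) + truncPow s (1 - |a| / x 0 * r)) := by
        rw [mul_add, ← truncPow_mul hx, ← truncPow_mul hx]
        have e1 : x 0 * (1 + |a| / x 0 * r) = x 0 + r * |a| := by field_simp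
        have e2 : x 0 * (1 - |a| / x 0 * r) = x 0 - r * |a| := by field_simp
        rw [e1, e2]
        rcases abs_cases a with ⟨h, _⟩ | ⟨h, _⟩
        · rw [h]
        · rw [h, mul_neg, sub_neg_eq_add, ← sub_eq_add_neg, add_comm]
      have hpow : r ^ (-1 - 2 * s) = r ^ (N - 1) / r ^ ((N : ℝ) + 2 * s) := by
        rw [← Real.rpow_natCast, ← Real.rpow_sub hr0, Nat.cast_pred (Nat.pos_of_ne_zero hN)]
        congr 1
        ring
      rw [truncPow_of_pos hx, hpow, sub_sub, hsymm]
      ring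
    · rw [indicator_of_notMem h, indicator_of_notMem (mt hmem.1 h), mul_zero]
  rw [setIntegral_congr_fun measurableSet_Ioi hpoint, setIntegral_indicator measurableSet_Ioo,
    inter_eq_self_of_subset_right (Ioo_subset_Ioi_self.trans (Ioi_subset_Ioi hε.le)), integral_const_mul,
    ← integral_Ioc_eq_integral_Ioo,
    integral_Ioc_eq_radialProfile hs (by positivity) hε hε1]

lemma tendsto_radialProfile {s b : ℝ} (hs : s ∈ Ioo (0 : ℝ) 1) (hb : 0 ≤ b) :
    Tendsto (fun ε => radialProfile s ε b) (𝓝[>] 0) (𝓝 0) := by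
  rcases hb.eq_or_lt with rfl | hb
  · simp [radialProfile, Real.zero_rpow (show 2 * s ≠ 0 by linarith [hs.1])]
  · have h1 : Tendsto (fun ε : ℝ => b * ε) (𝓝[>] 0) (𝓝[>] 0) := by
      refine tendsto_nhdsWithin_iff.2 ⟨?_, ?_⟩
      · have : Tendsto (fun ε : ℝ => b * ε) (𝓝 0) (𝓝 (b * 0)) := tendsto_id.const_mul b
        rw [mul_zero] at this
        exact this.mono_left nhdsWithin_le_nhds
      · filter_upwards [self_mem_nhdsWithin] with ε hε using mul_pos hb hε
    have h2 : Tendsto (fun ε : ℝ => b * (1 / ε)) (𝓝[>] 0) atTop := by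
      simpa only [one_div] using tendsto_inv_nhdsGT_zero.const_mul_atTop hb
    have h := (((tendsto_integral_Ioi_symmKernel_zero hs).comp h1).sub
      ((tendsto_integral_Ioi_symmKernel_atTop hs.1).comp h2)).const_mul (b ^ (2 * s))
    simpa [radialProfile] using h

lemma exists_abs_radialProfile_le {s : ℝ} (hs : s ∈ Ioo (0 : ℝ) 1) (B : ℝ) :
    ∃ C, ∀ ε b, 0 < ε → 0 ≤ b → b ≤ B → |radialProfile s ε b| ≤ C := by
  obtain ⟨C, hC⟩ := exists_abs_integral_Ioi_symmKernel_le hs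
  refine ⟨B ^ (2 * s) * (C + C), fun ε b hε hb hbB => ?_⟩
  have hs0 := hs.1
  have hC0 : 0 ≤ C := (abs_nonneg _).trans (hC 1 one_pos)
  have hB : 0 ≤ B := hb.trans hbB
  rcases hb.eq_or_lt with rfl | hb
  · rw [radialProfile, Real.zero_rpow (by linarith), zero_mul, abs_zero]
    positivity
  · rw [radialProfile, abs_mul, abs_of_nonneg (by positivity)]
    gcongr
    exact (abs_sub _ _).trans (add_le_add (hC _ (by positivity)) (hC _ (by positivity)))

lemma tendsto_pvInt_Qs (N : ℕ) [NeZero N] {s : ℝ} (hs : s ∈ Ioo (0 : ℝ) 1)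
    (x : EuclideanSpace ℝ (Fin N)) (hx : 0 < x 0) :
    Tendsto (fun ε => pvInt N s (Qs N s) x ε) (𝓝[>] 0) (𝓝 0) := by
  have : Nontrivial (EuclideanSpace ℝ (Fin N)) :=
    Module.nontrivial_of_finrank_pos (R := ℝ)
      (by rw [finrank_euclideanSpace_fin]; exact Nat.pos_of_ne_zero (NeZero.ne N))
  set σ := (volume : Measure (EuclideanSpace ℝ (Fin N))).toSphere
  set F : ℝ → Metric.sphere (0 : EuclideanSpace ℝ (Fin N)) 1 → ℝ := fun ε θ =>
    (x 0) ^ (s - 1) * radialProfile s ε (|(θ : EuclideanSpace ℝ (Fin N)) 0| / x 0) with hF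
  have hpolar : ∀ᶠ ε in 𝓝[>] (0 : ℝ), 0 < ε ∧ Integrable (F ε) σ ∧
      2⁻¹ * ∫ θ, F ε θ ∂σ = pvInt N s (Qs N s) x ε := by
    filter_upwards [Ioc_mem_nhdsGT (zero_lt_one' ℝ)] with ε hε
    obtain ⟨hint, hval⟩ := integrable_symmIntegrand_and_integral N hs.1 x hε.1
    obtain ⟨h1, h2⟩ := integrable_and_integral_toSphere volume hint
    simp only [integral_Ioi_symmIntegrand N hs.1 x hx hε.1 hε.2] at h1 h2
    refine ⟨hε.1, h1, ?_⟩
    rw [hF, ← h2, hval]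
    ring
  obtain ⟨C, hC⟩ := exists_abs_radialProfile_le hs (1 / x 0)
  have hlim : Tendsto (fun ε => ∫ θ, F ε θ ∂σ) (𝓝[>] 0) (𝓝 (∫ _, (0 : ℝ) ∂σ)) := by
    refine tendsto_integral_filter_of_dominated_convergence (fun _ => (x 0) ^ (s - 1) * C)
      (hpolar.mono fun ε h => h.2.1.aestronglyMeasurable)
      (hpolar.mono fun ε h => Eventually.of_forall fun θ => ?_) (integrable_const _)
      (Eventually.of_forall fun θ => ?_)
    · have hθ : ‖(θ : EuclideanSpace ℝ (Fin N))‖ = 1 := by simp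
      have hθ0 : |(θ : EuclideanSpace ℝ (Fin N)) 0| ≤ 1 :=
        (PiLp.norm_apply_le (θ : EuclideanSpace ℝ (Fin N)) 0).trans hθ.le
      rw [hF, Real.norm_eq_abs, abs_mul, abs_of_nonneg (by positivity)]
      gcongr
      exact hC _ _ h.1 (by positivity) (by gcongr)
    · simpa using (tendsto_radialProfile hs (by positivity)).const_mul ((x 0) ^ (s - 1))
  rw [integral_zero] at hlim
  have := hlim.const_mul 2⁻¹
  rw [mul_zero] at this
  exact this.congr' (hpolar.mono fun ε h => h.2.2)

/-- `𝒬_s` is `s`-harmonic in the upper half-space: at every `x` with `x₁ > 0`, the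
principal value limit of the truncated fractional Laplacian exists and equals `0`. -/
theorem Qs_sHarmonic
    (N : ℕ) [NeZero N] (hN : 2 ≤ N) (s : ℝ) (hs : s ∈ Ioo (0 : ℝ) 1) :
    ∀ x : EuclideanSpace ℝ (Fin N), 0 < x 0 → SHarmonicAt N s (Qs N s) x := by
  intro x hx
  simpa [SHarmonicAt] using (tendsto_pvInt_Qs N hs x hx).const_mul (cns N s)
end
end

section
/- Let N ≥ 2 and s ∈ (0,1). The function ℛ_s(x) = (x_1)_+^s (equal to x_1^s for x_1 > 0 and 0 for x_1 ≤ 0) is s-harmonic in the upper half space: for every x ∈ ℝ^N_+, lim_{ε→0^+} c_{N,s} ∫_{{z : ε<|z|<1/ε}} (ℛ_s(x) − ℛ_s(x+z)) |z|^{−N−2s} dz = 0, and moreover ∫_{ℝ^N_+} x_1^s (−Δ)^s φ(x) dx = 0 for every φ ∈ 𝕏_s(ℝ^N_+). -/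
open MeasureTheory Real Filter Set Topology

noncomputable section

/-- The test-function space `𝕏_s(ℝ^N_+)`: `ξ` belongs to it, with `L` the (everywhere on
`ℝ^N_+` existing, bounded) principal-value fractional Laplacian `(-Δ)^s ξ`. -/
structure TestFun (N : ℕ) [NeZero N] (s : ℝ)
    (ξ L : EuclideanSpace ℝ (Fin N) → ℝ) : Prop where
  cont : Continuous ξ
  cpt : HasCompactSupport ξ
  supp : tsupport ξ ⊆ {x : EuclideanSpace ℝ (Fin N) | 0 ≤ x 0}
  quot : ∃ g : EuclideanSpace ℝ (Fin N) → ℝ,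
    ContinuousOn g {x : EuclideanSpace ℝ (Fin N) | 0 ≤ x 0} ∧
    ∀ x : EuclideanSpace ℝ (Fin N), 0 < x 0 → g x = (x 0) ^ (-s) * ξ x
  pv : ∀ x : EuclideanSpace ℝ (Fin N), 0 < x 0 →
    Tendsto (fun ε : ℝ => cns N s * pvInt N s ξ x ε) (𝓝[>] (0 : ℝ)) (𝓝 (L x))
  bdd : ∃ C : ℝ, ∀ x : EuclideanSpace ℝ (Fin N), 0 < x 0 → |L x| ≤ C
  dom : ∃ (φ : EuclideanSpace ℝ (Fin N) → ℝ) (ε₀ : ℝ), 0 < ε₀ ∧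
    IntegrableOn (fun x : EuclideanSpace ℝ (Fin N) => φ x * (x 0) ^ s)
      {x : EuclideanSpace ℝ (Fin N) | 0 < x 0} ∧
    ∀ ε ∈ Ioc (0 : ℝ) ε₀, ∀ᵐ x : EuclideanSpace ℝ (Fin N),
      0 < x 0 → |cns N s * pvInt N s ξ x ε| ≤ φ x

/-- The function `ℛ_s(x) = (x₁)₊^s`. -/
def Rs (N : ℕ) [NeZero N] (s : ℝ) (x : EuclideanSpace ℝ (Fin N)) : ℝ :=
  if 0 < x 0 then (x 0) ^ s else 0

/-- The one-dimensional profile `t ↦ t₊^s`. -/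
def posPow (s t : ℝ) : ℝ := (max t 0) ^ s

/-- The centred second difference `2 - (1+t)₊^s - (1-t)₊^s`. -/
def secondDiff (s t : ℝ) : ℝ := 2 - posPow s (1 + t) - posPow s (1 - t)

lemma continuous_posPow {s : ℝ} (hs : 0 ≤ s) : Continuous (posPow s) :=
  (continuous_id.max continuous_const).rpow_const fun _ => Or.inr hs

lemma continuous_secondDiff {s : ℝ} (hs : 0 ≤ s) : Continuous (secondDiff s) := by
  have := continuous_posPow hs
  unfold secondDiff
  fun_prop

lemma posPow_of_nonneg {s t : ℝ} (ht : 0 ≤ t) : posPow s t = t ^ s := by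
  rw [posPow, max_eq_left ht]

lemma posPow_of_nonpos {s t : ℝ} (hs : s ≠ 0) (ht : t ≤ 0) : posPow s t = 0 := by
  rw [posPow, max_eq_right ht, Real.zero_rpow hs]

lemma posPow_mul {s a t : ℝ} (ha : 0 ≤ a) : posPow s (a * t) = a ^ s * posPow s t := by
  rw [posPow, posPow, ← Real.mul_rpow ha (le_max_right _ _), mul_max_of_nonneg _ _ ha, mul_zero]

lemma secondDiff_neg (s t : ℝ) : secondDiff s (-t) = secondDiff s t := by
  simp only [secondDiff, sub_neg_eq_add, ← sub_eq_add_neg]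
  ring

lemma secondDiff_abs (s t : ℝ) : secondDiff s |t| = secondDiff s t := by
  rcases abs_choice t with h | h <;> rw [h]
  exact secondDiff_neg s t

lemma secondDiff_zero (s : ℝ) : secondDiff s 0 = 0 := by
  norm_num [secondDiff, posPow]

lemma secondDiff_of_one_le {s t : ℝ} (hs : s ≠ 0) (ht : 1 ≤ t) :
    secondDiff s t = 2 - (1 + t) ^ s := by
  rw [secondDiff, posPow_of_nonneg (by linarith), posPow_of_nonpos hs (by linarith), sub_zero]

lemma secondDiff_of_mem_Icc {s t : ℝ} (ht : t ∈ Icc (0 : ℝ) 1) :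
    secondDiff s t = 2 - (1 + t) ^ s - (1 - t) ^ s := by
  rw [secondDiff, posPow_of_nonneg (by linarith [ht.1]), posPow_of_nonneg (by linarith [ht.2])]

lemma abs_secondDiff_le_of_mem_Icc {s t : ℝ} (hs : s ∈ Ioo (0 : ℝ) 1) (ht : t ∈ Icc (0 : ℝ) 1) :
    |secondDiff s t| ≤ 2 * t ^ 2 := by
  obtain ⟨hs0, hs1⟩ := hs
  obtain ⟨ht0, ht1⟩ := ht
  rw [secondDiff_of_mem_Icc ⟨ht0, ht1⟩]
  have hupper : ∀ u : ℝ, -1 ≤ u → ∀ p ∈ Ioo (0 : ℝ) 1, (1 + u) ^ p ≤ 1 + p * u := fun u hu p hp =>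
    rpow_one_add_le_one_add_mul_self hu hp.1.le hp.2.le
  have hprod : ∀ u : ℝ, -1 ≤ u → (1 + u) ^ s * (1 + (1 - s) * u) ≥ 1 + u := by
    intro u hu
    have h1 : 0 ≤ 1 + u := by linarith
    calc (1 + u) ^ s * (1 + (1 - s) * u) ≥ (1 + u) ^ s * (1 + u) ^ (1 - s) := by
          have := hupper u hu (1 - s) ⟨by linarith, by linarith⟩
          gcongr
      _ = 1 + u := by
          rw [← Real.rpow_add_of_nonneg h1 hs0.le (by linarith)]
          simp
  have hplus : 1 + s * t - t ^ 2 ≤ (1 + t) ^ s := by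
    have h := hprod t (by linarith)
    have hpos : 0 < 1 + (1 - s) * t := by nlinarith
    refine le_of_mul_le_mul_right (le_trans ?_ h) hpos
    nlinarith [mul_nonneg (sub_nonneg.2 hs1.le) (pow_nonneg ht0 3), sq_nonneg t,
      mul_nonneg (sq_nonneg t) (by nlinarith : 0 ≤ 1 - s * (1 - s))]
  have hminus : 1 - s * t - t ^ 2 ≤ (1 - t) ^ s := by
    have h := hprod (-t) (by linarith)
    have hpos : 0 < 1 + (1 - s) * -t := by nlinarith
    rw [← sub_eq_add_neg] at h
    refine le_of_mul_le_mul_right (le_trans ?_ h) hpos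
    nlinarith [mul_nonneg (mul_nonneg (sub_nonneg.2 hs1.le) (sq_nonneg t)) (sub_nonneg.2 ht1),
      mul_nonneg (sq_nonneg t) (sq_nonneg s)]
  have h1 := hupper t (by linarith) s ⟨hs0, hs1⟩
  have h2 := hupper (-t) (by linarith) s ⟨hs0, hs1⟩
  rw [← sub_eq_add_neg] at h2
  rw [abs_le]
  constructor <;> nlinarith

lemma abs_secondDiff_le_of_one_le {s t : ℝ} (hs : s ∈ Ioo (0 : ℝ) 1) (ht : 1 ≤ t) :
    |secondDiff s t| ≤ 2 * t ^ s := by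
  have hts : 1 ≤ t ^ s := Real.one_le_rpow ht hs.1.le
  have h1 : (1 + t) ^ s ≤ 2 * t ^ s := by
    calc (1 + t) ^ s ≤ (2 * t) ^ s := Real.rpow_le_rpow (by linarith) (by linarith) hs.1.le
      _ = 2 ^ s * t ^ s := Real.mul_rpow (by norm_num) (by linarith)
      _ ≤ 2 * t ^ s := by
        gcongr
        calc (2 : ℝ) ^ s ≤ 2 ^ (1 : ℝ) := Real.rpow_le_rpow_of_exponent_le (by norm_num) hs.2.le
          _ = 2 := Real.rpow_one 2
  have h2 : 0 ≤ (1 + t) ^ s := Real.rpow_nonneg (by linarith) _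
  rw [secondDiff_of_one_le hs.1.ne' ht, abs_le]
  constructor <;> linarith

lemma abs_secondDiff_le {s t r : ℝ} (hs : s ∈ Ioo (0 : ℝ) 1) (htr : |t| ≤ r) :
    |secondDiff s t| ≤ 2 * min (r ^ 2) (r ^ s) := by
  have h0 := abs_nonneg t
  have hmono : min (|t| ^ 2) (|t| ^ s) ≤ min (r ^ 2) (r ^ s) :=
    min_le_min (pow_le_pow_left₀ h0 htr 2) (Real.rpow_le_rpow h0 htr hs.1.le)
  refine le_trans ?_ (mul_le_mul_of_nonneg_left hmono zero_le_two)
  rw [← secondDiff_abs]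
  rcases le_total |t| 1 with h | h
  · refine (abs_secondDiff_le_of_mem_Icc hs ⟨h0, h⟩).trans_eq ?_
    rw [min_eq_left]
    rw [← Real.rpow_two]
    exact Real.rpow_le_rpow_of_exponent_ge_of_imp h0 h (by linarith [hs.2])
      fun _ h => absurd h two_ne_zero
  · refine (abs_secondDiff_le_of_one_le hs h).trans_eq ?_
    rw [min_eq_right]
    rw [← Real.rpow_two]
    exact Real.rpow_le_rpow_of_exponent_le h (by linarith [hs.2])

lemma integrableOn_min_mul_rpow {s : ℝ} (hs : s ∈ Ioo (0 : ℝ) 1) :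
    IntegrableOn (fun r : ℝ => min (r ^ 2) (r ^ s) * r ^ (-1 - 2 * s)) (Ioi 0) := by
  have hmeas : Measurable fun r : ℝ => min (r ^ 2) (r ^ s) * r ^ (-1 - 2 * s) := by fun_prop
  have hnorm : ∀ r : ℝ, 0 < r → ‖min (r ^ 2) (r ^ s) * r ^ (-1 - 2 * s)‖ =
      min (r ^ 2) (r ^ s) * r ^ (-1 - 2 * s) := fun r hr =>
    Real.norm_of_nonneg (by positivity)
  rw [← Ioc_union_Ioi_eq_Ioi zero_le_one]
  refine IntegrableOn.union ?_ ?_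
  · have h : IntegrableOn (fun r : ℝ => r ^ (1 - 2 * s)) (Ioc 0 1) :=
      (intervalIntegrable_iff_integrableOn_Ioc_of_le zero_le_one).1
        (intervalIntegral.intervalIntegrable_rpow' (by linarith [hs.2]))
    refine Integrable.mono' h hmeas.aestronglyMeasurable ?_
    filter_upwards [ae_restrict_mem measurableSet_Ioc] with r hr
    rw [hnorm r hr.1]
    calc min (r ^ 2) (r ^ s) * r ^ (-1 - 2 * s) ≤ r ^ 2 * r ^ (-1 - 2 * s) :=
          mul_le_mul_of_nonneg_right (min_le_left _ _) (Real.rpow_nonneg hr.1.le _)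
      _ = r ^ (1 - 2 * s) := by
          rw [← Real.rpow_two, ← Real.rpow_add hr.1]
          ring_nf
  · have h : IntegrableOn (fun r : ℝ => r ^ (-1 - s)) (Ioi 1) :=
      integrableOn_Ioi_rpow_of_lt (by linarith [hs.1]) one_pos
    refine Integrable.mono' h hmeas.aestronglyMeasurable ?_
    filter_upwards [ae_restrict_mem measurableSet_Ioi] with r hr
    have hr0 : 0 < r := one_pos.trans hr
    rw [hnorm r hr0]
    calc min (r ^ 2) (r ^ s) * r ^ (-1 - 2 * s) ≤ r ^ s * r ^ (-1 - 2 * s) :=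
          mul_le_mul_of_nonneg_right (min_le_right _ _) (Real.rpow_nonneg hr0.le _)
      _ = r ^ (-1 - s) := by
          rw [← Real.rpow_add hr0]
          ring_nf

lemma integrableOn_secondDiff_mul_rpow {s : ℝ} (hs : s ∈ Ioo (0 : ℝ) 1) :
    IntegrableOn (fun r : ℝ => secondDiff s r * r ^ (-1 - 2 * s)) (Ioi 0) := by
  refine Integrable.mono' ((integrableOn_min_mul_rpow hs).const_mul 2)
    ((continuous_secondDiff hs.1.le).measurable.mul (by fun_prop)).aestronglyMeasurable ?_
  filter_upwards [ae_restrict_mem measurableSet_Ioi] with r hr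
  have hr0 : (0 : ℝ) < r := hr
  rw [norm_mul, Real.norm_eq_abs, Real.norm_of_nonneg (Real.rpow_nonneg hr0.le _), ← mul_assoc]
  exact mul_le_mul_of_nonneg_right (abs_secondDiff_le hs (abs_of_pos hr0).le)
    (Real.rpow_nonneg hr0.le _)

/-- The forward difference quotient `((1+u)^s - 1) u^{-1-2s}`. -/
def forwardQuot (s u : ℝ) : ℝ := ((1 + u) ^ s - 1) * u ^ (-1 - 2 * s)

lemma continuousAt_forwardQuot {s u : ℝ} (hu : 0 < u) : ContinuousAt (forwardQuot s) u := by
  refine ContinuousAt.mul (ContinuousAt.sub (ContinuousAt.rpow_const (by fun_prop) ?_)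
    continuousAt_const) (Real.continuousAt_rpow_const _ _ (Or.inl hu.ne'))
  left
  positivity

lemma intervalIntegrable_forwardQuot {s a b : ℝ} (ha : 0 < a) (hb : 0 < b) :
    IntervalIntegrable (forwardQuot s) volume a b :=
  ContinuousOn.intervalIntegrable fun _ hu =>
    (continuousAt_forwardQuot ((lt_min ha hb).trans_le hu.1)).continuousWithinAt

lemma hasDerivAt_integral_forwardQuot {s x : ℝ} (hx : 0 < x) :
    HasDerivAt (fun y => ∫ u in (1 : ℝ)..y, forwardQuot s u) (forwardQuot s x) x := by
  refine intervalIntegral.integral_hasDerivAt_right (intervalIntegrable_forwardQuot one_pos hx) ?_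
    (continuousAt_forwardQuot hx)
  exact ContinuousAt.stronglyMeasurableAtFilter isOpen_Ioi
    (fun u hu => continuousAt_forwardQuot hu) x (mem_Ioi.2 hx)

lemma abs_forwardQuot_le {s u : ℝ} (hs : s ∈ Ioo (0 : ℝ) 1) (hu : 0 < u) :
    |forwardQuot s u| ≤ u ^ (-2 * s) := by
  have h1 : (1 + u) ^ s ≤ 1 + s * u :=
    rpow_one_add_le_one_add_mul_self (by linarith) hs.1.le hs.2.le
  have h2 : 1 ≤ (1 + u) ^ s := Real.one_le_rpow (by linarith) hs.1.le
  rw [forwardQuot, abs_of_nonneg (mul_nonneg (by linarith) (Real.rpow_nonneg hu.le _))]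
  calc ((1 + u) ^ s - 1) * u ^ (-1 - 2 * s) ≤ u * u ^ (-1 - 2 * s) := by
        refine mul_le_mul_of_nonneg_right ?_ (Real.rpow_nonneg hu.le _)
        nlinarith [hs.2]
    _ = u ^ (1 + (-1 - 2 * s)) := by rw [Real.rpow_add hu, Real.rpow_one]
    _ = u ^ (-2 * s) := by ring_nf

lemma integrableOn_forwardQuot {s : ℝ} (hs : s ∈ Ioo (0 : ℝ) 1) :
    IntegrableOn (forwardQuot s) (Ioi 1) := by
  have h1 : IntegrableOn (fun r : ℝ => secondDiff s r * r ^ (-1 - 2 * s)) (Ioi 1) :=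
    (integrableOn_secondDiff_mul_rpow hs).mono_set (Ioi_subset_Ioi zero_le_one)
  have h2 : IntegrableOn (fun r : ℝ => r ^ (-1 - 2 * s)) (Ioi 1) :=
    integrableOn_Ioi_rpow_of_lt (by linarith [hs.1]) one_pos
  refine (h2.sub h1).congr_fun (fun r hr => ?_) measurableSet_Ioi
  simp only [forwardQuot, Pi.sub_apply]
  rw [secondDiff_of_one_le hs.1.ne' (le_of_lt hr)]
  ring

/-- An antiderivative of `secondDiff s t * t ^ (-1 - 2 * s)` on `(0, 1)`. -/
def secondDiffPrimitive (s t : ℝ) : ℝ :=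
  (∫ u in (1 : ℝ)..t / (1 - t), forwardQuot s u) - (∫ u in (1 : ℝ)..t, forwardQuot s u) -
    1 / (2 * s) * ((1 - (1 - t) ^ s) ^ 2 * t ^ (-2 * s))

lemma hasDerivAt_secondDiffPrimitive {s t : ℝ} (hs : s ∈ Ioo (0 : ℝ) 1) (ht : t ∈ Ioo (0 : ℝ) 1) :
    HasDerivAt (secondDiffPrimitive s) (secondDiff s t * t ^ (-1 - 2 * s)) t := by
  obtain ⟨ht0, ht1⟩ := ht
  have hw : 0 < 1 - t := by linarith
  have hu : 0 < t / (1 - t) := by positivity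
  have hsub : HasDerivAt (fun t : ℝ => 1 - t) (-1) t := by
    simpa using (hasDerivAt_id t).const_sub 1
  have hdiv : HasDerivAt (fun t : ℝ => t / (1 - t)) (1 / (1 - t) ^ 2) t := by
    refine ((hasDerivAt_id t).div hsub hw.ne').congr_deriv ?_
    simp
  have hA := (hasDerivAt_integral_forwardQuot (s := s) hu).comp t hdiv
  have hB := hasDerivAt_integral_forwardQuot (s := s) ht0
  have hC := (((hsub.rpow_const (p := s) (Or.inl hw.ne')).const_sub 1).pow 2).mul
    ((hasDerivAt_id t).rpow_const (p := -2 * s) (Or.inl ht0.ne'))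
  refine ((hA.sub hB).sub (hC.const_mul (1 / (2 * s)))).congr_deriv ?_
  rw [secondDiff_of_mem_Icc ⟨ht0.le, ht1.le⟩]
  have hs0 := hs.1.ne'
  have e1 : 1 + t / (1 - t) = (1 - t)⁻¹ := by field_simp; ring
  have e2 : (1 - t) ^ (s - 1) = (1 - t) ^ s / (1 - t) := Real.rpow_sub_one hw.ne' s
  have e3 : t ^ (-2 * s - 1) = t ^ (-1 - 2 * s) := by ring_nf
  have e4 : t ^ (-2 * s) = t * t ^ (-1 - 2 * s) := by
    rw [show -2 * s = 1 + (-1 - 2 * s) by ring, Real.rpow_add ht0, Real.rpow_one]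
  have e5 : (1 - t) ^ (-1 - 2 * s) = ((1 - t) * ((1 - t) ^ s) ^ 2)⁻¹ := by
    rw [show -1 - 2 * s = -(1 + s * (2 : ℕ)) by push_cast; ring, Real.rpow_neg hw.le,
      Real.rpow_add hw, Real.rpow_one, Real.rpow_mul hw.le, Real.rpow_natCast]
  simp only [forwardQuot, id, Pi.pow_apply, Real.div_rpow ht0.le hw.le]
  rw [e1, e2, e3, e4, e5, Real.inv_rpow hw.le]
  have hW : (1 - t) ^ s ≠ 0 := (Real.rpow_pos_of_pos hw s).ne'
  have hw' := hw.ne'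
  generalize (1 - t) ^ s = W at *
  generalize t ^ (-1 - 2 * s) = T at *
  field_simp
  ring

lemma tendsto_secondDiffPrimitive_zero {s : ℝ} (hs : s ∈ Ioo (0 : ℝ) 1) :
    Tendsto (secondDiffPrimitive s) (𝓝[>] 0) (𝓝 0) := by
  have hlim : Tendsto (fun t : ℝ => t ^ (2 - 2 * s)) (𝓝[>] 0) (𝓝 0) := by
    have h := (Real.continuousAt_rpow_const 0 (2 - 2 * s) (Or.inr (by linarith [hs.2]))).tendsto
    rw [Real.zero_rpow (by linarith [hs.2])] at h
    exact h.mono_left nhdsWithin_le_nhds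
  refine squeeze_zero_norm' ?_ ((hlim.const_mul (2 + 1 / (2 * s))).trans (by simp))
  filter_upwards [Ioo_mem_nhdsGT (show (0 : ℝ) < 1 / 2 by norm_num)] with t ht
  obtain ⟨ht0, ht1⟩ := ht
  have hw : 0 < 1 - t := by linarith
  have hu : 0 < t / (1 - t) := by positivity
  have htu : t ≤ t / (1 - t) := by
    rw [le_div_iff₀ hw]
    nlinarith
  have hpow : t ^ (2 - 2 * s) = t ^ (-2 * s) * t ^ 2 := by
    rw [← Real.rpow_two, ← Real.rpow_add ht0]
    ring_nf
  have hint : ‖∫ u in t..t / (1 - t), forwardQuot s u‖ ≤ 2 * t ^ (2 - 2 * s) := by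
    refine (intervalIntegral.norm_integral_le_of_norm_le_const (C := t ^ (-2 * s))
      fun u hu => ?_).trans ?_
    · rw [uIoc_of_le htu] at hu
      refine (abs_forwardQuot_le hs (ht0.trans hu.1)).trans ?_
      exact Real.rpow_le_rpow_of_nonpos ht0 hu.1.le (by linarith [hs.1])
    · rw [hpow, abs_of_nonneg (by linarith)]
      have : t / (1 - t) - t ≤ 2 * t ^ 2 := by
        rw [sub_le_iff_le_add, div_le_iff₀ hw]
        nlinarith [mul_nonneg (sq_nonneg t) (by linarith : (0 : ℝ) ≤ 1 - 2 * t)]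
      calc t ^ (-2 * s) * (t / (1 - t) - t) ≤ t ^ (-2 * s) * (2 * t ^ 2) :=
            mul_le_mul_of_nonneg_left this (Real.rpow_nonneg ht0.le _)
        _ = _ := by ring
  have hsq : (1 - (1 - t) ^ s) ^ 2 ≤ t ^ 2 := by
    have h1 : (1 - t) ^ s ≤ 1 := Real.rpow_le_one hw.le (by linarith) hs.1.le
    have h2 : 1 - t ≤ (1 - t) ^ s := by
      simpa using Real.rpow_le_rpow_of_exponent_ge hw (by linarith) hs.2.le
    exact pow_le_pow_left₀ (by linarith) (by linarith) 2
  have hs0 := hs.1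
  rw [secondDiffPrimitive, intervalIntegral.integral_interval_sub_left
    (intervalIntegrable_forwardQuot one_pos hu) (intervalIntegrable_forwardQuot one_pos ht0),
    add_mul]
  refine (norm_sub_le _ _).trans (add_le_add hint ?_)
  rw [Real.norm_of_nonneg (by positivity), hpow, mul_comm (t ^ (-2 * s))]
  gcongr

lemma tendsto_secondDiffPrimitive_one {s : ℝ} (hs : s ∈ Ioo (0 : ℝ) 1) :
    Tendsto (secondDiffPrimitive s) (𝓝[<] 1)
      (𝓝 ((∫ u in Ioi 1, forwardQuot s u) - 1 / (2 * s))) := by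
  have hsub : Tendsto (fun t : ℝ => 1 - t) (𝓝[<] 1) (𝓝[>] 0) := by
    refine tendsto_nhdsWithin_iff.2 ⟨?_, ?_⟩
    · have : Tendsto (fun t : ℝ => 1 - t) (𝓝 1) (𝓝 (1 - 1)) := by
        exact (continuous_const.sub continuous_id).tendsto 1
      simpa using this.mono_left nhdsWithin_le_nhds
    · filter_upwards [self_mem_nhdsWithin] with t ht
      simpa using ht
  have hid : Tendsto (fun t : ℝ => t) (𝓝[<] 1) (𝓝 1) := tendsto_id.mono_left nhdsWithin_le_nhds
  have hdiv : Tendsto (fun t : ℝ => t / (1 - t)) (𝓝[<] 1) atTop := by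
    simp_rw [div_eq_mul_inv]
    exact hid.pos_mul_atTop one_pos (tendsto_inv_nhdsGT_zero.comp hsub)
  have hA := intervalIntegral_tendsto_integral_Ioi 1 (integrableOn_forwardQuot hs) hdiv
  have hB : Tendsto (fun t => ∫ u in (1 : ℝ)..t, forwardQuot s u) (𝓝[<] 1) (𝓝 0) := by
    have h := (hasDerivAt_integral_forwardQuot (s := s) one_pos).continuousAt.tendsto
    simp only [intervalIntegral.integral_same] at h
    exact h.mono_left nhdsWithin_le_nhds
  have hC : Tendsto (fun t : ℝ => (1 - (1 - t) ^ s) ^ 2 * t ^ (-2 * s)) (𝓝[<] 1) (𝓝 1) := by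
    have h1 := (hsub.mono_right nhdsWithin_le_nhds).rpow_const (p := s) (Or.inr hs.1.le)
    have h2 := hid.rpow_const (p := -2 * s) (Or.inl one_ne_zero)
    rw [Real.zero_rpow hs.1.ne'] at h1
    rw [Real.one_rpow] at h2
    simpa using ((h1.const_sub 1).pow 2).mul h2
  have := (hA.sub hB).sub (hC.const_mul (1 / (2 * s)))
  rwa [sub_zero, mul_one] at this

theorem integral_secondDiff_mul_rpow {s : ℝ} (hs : s ∈ Ioo (0 : ℝ) 1) :
    ∫ r in Ioi 0, secondDiff s r * r ^ (-1 - 2 * s) = 0 := by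
  have hint := integrableOn_secondDiff_mul_rpow hs
  have hint0 : IntegrableOn (fun r : ℝ => secondDiff s r * r ^ (-1 - 2 * s)) (Ioc 0 1) :=
    hint.mono_set Ioc_subset_Ioi_self
  have hint1 : IntegrableOn (fun r : ℝ => secondDiff s r * r ^ (-1 - 2 * s)) (Ioi 1) :=
    hint.mono_set (Ioi_subset_Ioi zero_le_one)
  have h0 : ∫ r in Ioc 0 1, secondDiff s r * r ^ (-1 - 2 * s) =
      (∫ u in Ioi 1, forwardQuot s u) - 1 / (2 * s) := by
    rw [← intervalIntegral.integral_of_le zero_le_one,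
      intervalIntegral.integral_eq_sub_of_hasDerivAt_of_tendsto one_pos
        (fun t ht => hasDerivAt_secondDiffPrimitive hs ht)
        ((intervalIntegrable_iff_integrableOn_Ioc_of_le zero_le_one).2 hint0)
        (tendsto_secondDiffPrimitive_zero hs) (tendsto_secondDiffPrimitive_one hs), sub_zero]
  have h1 : ∫ r in Ioi 1, secondDiff s r * r ^ (-1 - 2 * s) =
      1 / (2 * s) - ∫ u in Ioi 1, forwardQuot s u := by
    have hpow : IntegrableOn (fun r : ℝ => r ^ (-1 - 2 * s)) (Ioi 1) :=
      integrableOn_Ioi_rpow_of_lt (by linarith [hs.1]) one_pos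
    have hval : ∫ r in Ioi (1 : ℝ), r ^ (-1 - 2 * s) = 1 / (2 * s) := by
      rw [integral_Ioi_rpow_of_lt (by linarith [hs.1]) one_pos, Real.one_rpow,
        show -1 - 2 * s + 1 = -(2 * s) by ring, neg_div_neg_eq]
    rw [← hval, ← integral_sub hpow (integrableOn_forwardQuot hs)]
    refine setIntegral_congr_fun measurableSet_Ioi fun r hr => ?_
    simp only [forwardQuot]
    rw [secondDiff_of_one_le hs.1.ne' (le_of_lt hr)]
    ring
  rw [← Ioc_union_Ioi_eq_Ioi zero_le_one, setIntegral_union Ioc_disjoint_Ioi_same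
    measurableSet_Ioi hint0 hint1, h0, h1]
  ring

lemma measurable_coord {N : ℕ} (i : Fin N) : Measurable fun z : EuclideanSpace ℝ (Fin N) => z i :=
  (EuclideanSpace.proj i : EuclideanSpace ℝ (Fin N) →L[ℝ] ℝ).continuous.measurable

/-- The kernel of the symmetrised fractional Laplacian of `t₊^s` at height one. -/
def secondDiffKernel (N : ℕ) [NeZero N] (s : ℝ) (z : EuclideanSpace ℝ (Fin N)) : ℝ :=
  secondDiff s (z 0) / ‖z‖ ^ ((N : ℝ) + 2 * s)

lemma measurable_secondDiffKernel (N : ℕ) [NeZero N] {s : ℝ} (hs : 0 ≤ s) :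
    Measurable (secondDiffKernel N s) :=
  ((continuous_secondDiff hs).measurable.comp (measurable_coord 0)).div
    (measurable_norm.pow_const _)

lemma pow_mul_div_rpow {N : ℕ} [NeZero N] {s r : ℝ} (hr : 0 < r) (a : ℝ) :
    r ^ (N - 1) * (a / r ^ ((N : ℝ) + 2 * s)) = a * r ^ (-1 - 2 * s) := by
  have h : r ^ (-1 - 2 * s) = r ^ (N - 1) / r ^ ((N : ℝ) + 2 * s) := by
    rw [← Real.rpow_natCast, ← Real.rpow_sub hr, Nat.cast_pred (NeZero.pos N)]
    ring_nf
  rw [h]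
  ring

lemma integrable_secondDiffKernel (N : ℕ) [NeZero N] {s : ℝ} (hs : s ∈ Ioo (0 : ℝ) 1) :
    Integrable (secondDiffKernel N s) := by
  have hmaj : Integrable fun z : EuclideanSpace ℝ (Fin N) =>
      2 * (min (‖z‖ ^ 2) (‖z‖ ^ s) / ‖z‖ ^ ((N : ℝ) + 2 * s)) := by
    refine Integrable.const_mul ?_ 2
    refine (integrable_fun_norm_addHaar volume
      (f := fun r : ℝ => min (r ^ 2) (r ^ s) / r ^ ((N : ℝ) + 2 * s))).2 ?_
    refine (integrableOn_min_mul_rpow hs).congr_fun (fun r hr => ?_) measurableSet_Ioi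
    simp only [finrank_euclideanSpace, Fintype.card_fin, smul_eq_mul]
    exact (pow_mul_div_rpow hr _).symm
  refine hmaj.mono' (measurable_secondDiffKernel N hs.1.le).aestronglyMeasurable
    (.of_forall fun z => ?_)
  rw [secondDiffKernel, norm_div, Real.norm_eq_abs,
    Real.norm_of_nonneg (Real.rpow_nonneg (norm_nonneg z) _), ← mul_div_assoc]
  exact div_le_div_of_nonneg_right (abs_secondDiff_le hs (PiLp.norm_apply_le z 0))
    (Real.rpow_nonneg (norm_nonneg z) _)

lemma integral_secondDiff_mul_const {s : ℝ} (hs : s ∈ Ioo (0 : ℝ) 1) (c : ℝ) :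
    ∫ r in Ioi 0, secondDiff s (r * c) * r ^ (-1 - 2 * s) = 0 := by
  rw [setIntegral_congr_fun (g := fun r => secondDiff s (r * |c|) * r ^ (-1 - 2 * s))
    measurableSet_Ioi]
  · rcases (abs_nonneg c).eq_or_lt with h | h
    · simp [← h, secondDiff_zero]
    · rw [setIntegral_congr_fun (g := fun r =>
          |c| ^ (1 + 2 * s) * (secondDiff s (r * |c|) * (r * |c|) ^ (-1 - 2 * s)))
        measurableSet_Ioi, integral_const_mul, integral_comp_mul_right_Ioi
          (fun u => secondDiff s u * u ^ (-1 - 2 * s)) 0 h, zero_mul,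
        integral_secondDiff_mul_rpow hs, smul_zero, mul_zero]
      intro r hr
      have hinv : |c| ^ (1 + 2 * s) * |c| ^ (-1 - 2 * s) = 1 := by
        rw [← Real.rpow_add h]
        ring_nf
        simp
      simp only
      rw [Real.mul_rpow (le_of_lt hr) h.le]
      linear_combination -(secondDiff s (r * |c|) * r ^ (-1 - 2 * s)) * hinv
  · intro r hr
    simp only
    rw [← secondDiff_abs, abs_mul, abs_of_pos (mem_Ioi.1 hr)]

theorem integral_secondDiffKernel (N : ℕ) [NeZero N] {s : ℝ} (hs : s ∈ Ioo (0 : ℝ) 1) :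
    ∫ z, secondDiffKernel N s z = 0 := by
  let E := EuclideanSpace ℝ (Fin N)
  let F : Metric.sphere (0 : E) 1 × Ioi (0 : ℝ) → ℝ := fun p =>
    secondDiffKernel N s (p.2.1 • p.1.1)
  have hmp := (volume : Measure E).measurePreserving_homeomorphUnitSphereProd
  have hemb := (homeomorphUnitSphereProd E).measurableEmbedding
  have hcomp : F ∘ homeomorphUnitSphereProd E = fun z => secondDiffKernel N s z.1 := by
    funext z
    simp only [F, Function.comp]
    rw [← homeomorphUnitSphereProd_symm_apply_coe, Homeomorph.symm_apply_apply]
  have hF : Integrable F ((volume : Measure E).toSphere.prod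
      (.volumeIoiPow (Module.finrank ℝ E - 1))) := by
    rw [← hmp.integrable_comp_emb hemb, hcomp]
    exact (integrableOn_iff_comap_subtypeVal (measurableSet_singleton _).compl).1
      (integrable_secondDiffKernel N hs).integrableOn
  calc ∫ z, secondDiffKernel N s z
      = ∫ z : ({(0)}ᶜ : Set E), secondDiffKernel N s z.1 ∂(Measure.comap (Subtype.val) volume) := by
        rw [integral_subtype_comap (measurableSet_singleton _).compl (secondDiffKernel N s),
          restrict_compl_singleton]
    _ = ∫ p, F p ∂((volume : Measure E).toSphere.prod
          (.volumeIoiPow (Module.finrank ℝ E - 1))) := by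
        rw [← hmp.integral_comp hemb F]
        exact integral_congr_ae (.of_forall fun z => (congrFun hcomp z).symm)
    _ = 0 := by
        rw [integral_prod _ hF]
        refine integral_eq_zero_of_ae (.of_forall fun ω => ?_)
        simp only [Measure.volumeIoiPow, ENNReal.ofReal]
        rw [integral_withDensity_eq_integral_smul
          (measurable_subtype_coe.pow_const _).real_toNNReal,
          integral_subtype_comap measurableSet_Ioi fun r : ℝ =>
            Real.toNNReal (r ^ (Module.finrank ℝ E - 1)) • secondDiffKernel N s (r • ω.1),
          setIntegral_congr_fun (g := fun r => secondDiff s (r * ω.1 0) * r ^ (-1 - 2 * s))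
            measurableSet_Ioi, integral_secondDiff_mul_const hs]
        · rfl
        intro r hr
        have hr0 : (0 : ℝ) < r := hr
        simp only [NNReal.smul_def, Real.coe_toNNReal _ (pow_nonneg hr0.le _), smul_eq_mul,
          secondDiffKernel, norm_smul, norm_eq_of_mem_sphere, mul_one, Real.norm_of_nonneg hr0.le,
          PiLp.smul_apply, E, finrank_euclideanSpace, Fintype.card_fin]
        exact pow_mul_div_rpow hr0 _

lemma Rs_eq_posPow {N : ℕ} [NeZero N] {s : ℝ} (hs : s ≠ 0) (x : EuclideanSpace ℝ (Fin N)) :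
    Rs N s x = posPow s (x 0) := by
  rw [Rs]
  split_ifs with h
  · rw [posPow_of_nonneg h.le]
  · rw [posPow_of_nonpos hs (not_lt.1 h)]

lemma continuous_Rs {N : ℕ} [NeZero N] {s : ℝ} (hs : 0 < s) : Continuous (Rs N s) := by
  rw [funext (Rs_eq_posPow hs.ne')]
  exact (continuous_posPow hs.le).comp
    (EuclideanSpace.proj 0 : EuclideanSpace ℝ (Fin N) →L[ℝ] ℝ).continuous

lemma setIntegral_annulus_neg {N : ℕ} (ε : ℝ) (f : EuclideanSpace ℝ (Fin N) → ℝ) :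
    ∫ z in annulus N ε, f (-z) = ∫ z in annulus N ε, f z := by
  rw [← integral_indicator (measurableSet_annulus N ε),
    ← integral_indicator (measurableSet_annulus N ε), ← integral_neg_eq_self]
  congr 1
  funext z
  simp [indicator, annulus]

/-- A continuous function that vanishes for large `x` is integrable against the truncated kernel. -/
lemma integrable_prod_div_norm_rpow {N : ℕ} {p ε R : ℝ} (hε : 0 < ε)
    {G : EuclideanSpace ℝ (Fin N) × EuclideanSpace ℝ (Fin N) → ℝ} (hG : Continuous G)
    (hzero : ∀ q, R < ‖q.1‖ → ‖q.2‖ < 1 / ε → G q = 0) :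
    Integrable (fun q => G q / ‖q.2‖ ^ p) (volume.prod (volume.restrict (annulus N ε))) := by
  let A : Set (EuclideanSpace ℝ (Fin N)) := Metric.closedBall 0 (1 / ε) ∩ {z | ε ≤ ‖z‖}
  have hA : IsCompact A :=
    (isCompact_closedBall _ _).inter_right (isClosed_le continuous_const continuous_norm)
  have hcompact : IsCompact (Metric.closedBall (0 : EuclideanSpace ℝ (Fin N)) R ×ˢ A) :=
    (isCompact_closedBall _ _).prod hA
  have hcont : ContinuousOn (fun q : EuclideanSpace ℝ (Fin N) × EuclideanSpace ℝ (Fin N) =>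
      G q / ‖q.2‖ ^ p) (Metric.closedBall (0 : EuclideanSpace ℝ (Fin N)) R ×ˢ A) := by
    have hpos : ∀ q ∈ Metric.closedBall (0 : EuclideanSpace ℝ (Fin N)) R ×ˢ A, 0 < ‖q.2‖ :=
      fun q hq => hε.trans_le hq.2.2
    refine hG.continuousOn.div ?_ fun q hq => (Real.rpow_pos_of_pos (hpos q hq) p).ne'
    exact (by fun_prop : ContinuousOn (fun q : EuclideanSpace ℝ (Fin N) ×
      EuclideanSpace ℝ (Fin N) => ‖q.2‖) _).rpow_const fun q hq => Or.inl (hpos q hq).ne'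
  have hint : IntegrableOn (fun q : EuclideanSpace ℝ (Fin N) × EuclideanSpace ℝ (Fin N) =>
      G q / ‖q.2‖ ^ p) (Metric.closedBall (0 : EuclideanSpace ℝ (Fin N)) R ×ˢ A)
      (volume.prod volume) := hcont.integrableOn_compact hcompact
  have hprod : (volume : Measure (EuclideanSpace ℝ (Fin N))).prod
      (volume.restrict (annulus N ε)) =
      (volume.prod volume).restrict (univ ×ˢ annulus N ε) := by
    rw [← Measure.prod_restrict, Measure.restrict_univ]
  rw [hprod]
  refine IntegrableOn.of_forall_sdiff_eq_zero hint (MeasurableSet.univ.prod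
    (measurableSet_annulus N ε)) fun q hq => ?_
  have hq2 : q.2 ∈ annulus N ε := hq.1.2
  rw [hzero q ?_ hq2.2, zero_div]
  by_contra hle
  exact hq.2 ⟨by simpa using hle, by simpa using hq2.2.le, hq2.1.le⟩

lemma integrableOn_annulus_div_norm_rpow {N : ℕ} {p ε : ℝ} (hε : 0 < ε)
    {f : EuclideanSpace ℝ (Fin N) → ℝ} (hf : Continuous f) :
    IntegrableOn (fun z => f z / ‖z‖ ^ p) (annulus N ε) := by
  let A : Set (EuclideanSpace ℝ (Fin N)) := Metric.closedBall 0 (1 / ε) ∩ {z | ε ≤ ‖z‖}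
  have hA : IsCompact A :=
    (isCompact_closedBall _ _).inter_right (isClosed_le continuous_const continuous_norm)
  have hpos : ∀ z ∈ A, 0 < ‖z‖ := fun z hz => hε.trans_le hz.2
  have hcont : ContinuousOn (fun z => f z / ‖z‖ ^ p) A :=
    hf.continuousOn.div (continuous_norm.continuousOn.rpow_const fun z hz => Or.inl (hpos z hz).ne')
      fun z hz => (Real.rpow_pos_of_pos (hpos z hz) p).ne'
  exact (hcont.integrableOn_compact hA).mono_set fun z hz => ⟨by simpa using hz.2.le, hz.1.le⟩

lemma pvInt_Rs {N : ℕ} [NeZero N] {s ε : ℝ} (hs : 0 < s) (hε : 0 < ε)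
    {x : EuclideanSpace ℝ (Fin N)} (hx : 0 < x 0) :
    pvInt N s (Rs N s) x ε = (x 0) ^ (s - ((N : ℝ) + 2 * s)) / 2 *
      ∫ z in annulus N ε, secondDiffKernel N s ((x 0)⁻¹ • z) := by
  have hR := continuous_Rs (N := N) hs
  have hplus : IntegrableOn (fun z => (Rs N s x - Rs N s (x + z)) / ‖z‖ ^ ((N : ℝ) + 2 * s))
      (annulus N ε) := integrableOn_annulus_div_norm_rpow hε (by fun_prop)
  have hminus : IntegrableOn (fun z => (Rs N s x - Rs N s (x + -z)) / ‖z‖ ^ ((N : ℝ) + 2 * s))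
      (annulus N ε) := integrableOn_annulus_div_norm_rpow hε (by fun_prop)
  have hneg : pvInt N s (Rs N s) x ε =
      ∫ z in annulus N ε, (Rs N s x - Rs N s (x + -z)) / ‖z‖ ^ ((N : ℝ) + 2 * s) := by
    rw [pvInt, ← setIntegral_annulus_neg]
    simp only [norm_neg]
  have hsum : 2 * pvInt N s (Rs N s) x ε = ∫ z in annulus N ε,
      (x 0) ^ (s - ((N : ℝ) + 2 * s)) * secondDiffKernel N s ((x 0)⁻¹ • z) := by
    rw [two_mul]
    nth_rewrite 2 [hneg]
    rw [pvInt, ← integral_add hplus hminus]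
    congr 1
    funext z
    have hscale : ∀ t : ℝ, posPow s (x 0 + t) = (x 0) ^ s * posPow s (1 + (x 0)⁻¹ * t) := fun t => by
      rw [← posPow_mul hx.le]
      congr 1
      field_simp
    simp only [Rs_eq_posPow hs.ne', PiLp.add_apply, PiLp.neg_apply, secondDiffKernel, secondDiff,
      PiLp.smul_apply, smul_eq_mul, norm_smul, norm_inv, Real.norm_of_nonneg hx.le]
    rw [hscale, hscale, posPow_of_nonneg hx.le, Real.mul_rpow (inv_nonneg.2 hx.le) (norm_nonneg z),
      Real.inv_rpow hx.le, Real.rpow_sub hx]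
    have := (Real.rpow_pos_of_pos hx ((N : ℝ) + 2 * s)).ne'
    rw [mul_neg, ← sub_eq_add_neg]
    field_simp
    ring
  rw [integral_const_mul] at hsum
  linear_combination hsum / 2

lemma tendsto_setIntegral_annulus {N : ℕ} [NeZero N] {f : EuclideanSpace ℝ (Fin N) → ℝ}
    (hf : Integrable f) :
    Tendsto (fun ε => ∫ z in annulus N ε, f z) (𝓝[>] 0) (𝓝 (∫ z, f z)) := by
  simp_rw [← integral_indicator (measurableSet_annulus N _)]
  refine tendsto_integral_filter_of_dominated_convergence (fun z => ‖f z‖)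
    (.of_forall fun ε => hf.aestronglyMeasurable.indicator (measurableSet_annulus N ε))
    (.of_forall fun ε => .of_forall fun z => norm_indicator_le_norm_self _ _) hf.norm ?_
  filter_upwards [Measure.ae_ne volume (0 : EuclideanSpace ℝ (Fin N))] with z hz
  have hz0 : 0 < ‖z‖ := norm_pos_iff.2 hz
  refine tendsto_const_nhds.congr' ?_
  filter_upwards [Ioo_mem_nhdsGT (lt_min hz0 (inv_pos.2 hz0))] with ε hε
  have hmem : z ∈ annulus N ε := by
    refine ⟨hε.2.trans_le (min_le_left _ _), ?_⟩
    rw [one_div]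
    exact (lt_inv_comm₀ hε.1 hz0).1 (hε.2.trans_le (min_le_right _ _))
  rw [indicator_of_mem hmem]

theorem tendsto_pvInt_Rs {N : ℕ} [NeZero N] {s : ℝ} (hs : s ∈ Ioo (0 : ℝ) 1)
    {x : EuclideanSpace ℝ (Fin N)} (hx : 0 < x 0) :
    Tendsto (fun ε => pvInt N s (Rs N s) x ε) (𝓝[>] 0) (𝓝 0) := by
  have hlim := (tendsto_setIntegral_annulus ((integrable_secondDiffKernel N hs).comp_smul
    (inv_ne_zero hx.ne'))).const_mul ((x 0) ^ (s - ((N : ℝ) + 2 * s)) / 2)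
  rw [Measure.integral_comp_inv_smul, integral_secondDiffKernel N hs, smul_zero, mul_zero] at hlim
  refine hlim.congr' ?_
  filter_upwards [self_mem_nhdsWithin] with ε hε
  exact (pvInt_Rs hs.1 hε hx).symm

lemma rpow_mul_abs_pvInt_Rs_le {N : ℕ} [NeZero N] {s ε : ℝ} (hs : s ∈ Ioo (0 : ℝ) 1) (hε : 0 < ε)
    {x : EuclideanSpace ℝ (Fin N)} (hx : 0 < x 0) :
    (x 0) ^ s * |pvInt N s (Rs N s) x ε| ≤ (∫ z, |secondDiffKernel N s z|) / 2 := by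
  have hint := (integrable_secondDiffKernel N hs).comp_smul (inv_ne_zero hx.ne')
  have hbound : |∫ z in annulus N ε, secondDiffKernel N s ((x 0)⁻¹ • z)| ≤
      (x 0) ^ N * ∫ z, |secondDiffKernel N s z| := by
    calc |∫ z in annulus N ε, secondDiffKernel N s ((x 0)⁻¹ • z)|
        ≤ ∫ z in annulus N ε, |secondDiffKernel N s ((x 0)⁻¹ • z)| := abs_integral_le_integral_abs
      _ ≤ ∫ z, |secondDiffKernel N s ((x 0)⁻¹ • z)| :=
        setIntegral_le_integral hint.abs (.of_forall fun z => abs_nonneg _)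
      _ = (x 0) ^ N * ∫ z, |secondDiffKernel N s z| := by
        rw [Measure.integral_comp_inv_smul volume (fun z => |secondDiffKernel N s z|),
          finrank_euclideanSpace, Fintype.card_fin, abs_of_pos (pow_pos hx N), smul_eq_mul]
  have hone : (x 0) ^ s * (x 0) ^ (s - ((N : ℝ) + 2 * s)) * (x 0) ^ N = 1 := by
    rw [← Real.rpow_natCast, ← Real.rpow_add hx, ← Real.rpow_add hx]
    ring_nf
    simp
  have hp : 0 ≤ (x 0) ^ s * ((x 0) ^ (s - ((N : ℝ) + 2 * s)) / 2) := by positivity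
  rw [pvInt_Rs hs.1 hε hx, abs_mul, abs_of_nonneg (a := _ / 2) (by positivity), ← mul_assoc]
  refine (mul_le_mul_of_nonneg_left hbound hp).trans_eq ?_
  linear_combination (∫ z, |secondDiffKernel N s z|) / 2 * hone

/-- The truncated fractional Laplacian is symmetric. -/
theorem integral_mul_pvInt_comm {N : ℕ} {s ε : ℝ} (hε : 0 < ε)
    {u v : EuclideanSpace ℝ (Fin N) → ℝ} (hu : Continuous u) (hcu : HasCompactSupport u)
    (hv : Continuous v) :
    ∫ x, v x * pvInt N s u x ε = ∫ x, u x * pvInt N s v x ε := by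
  obtain ⟨R, hR⟩ := hcu.isCompact.isBounded.subset_closedBall 0
  have hu0 : ∀ x, R < ‖x‖ → u x = 0 := fun x hx =>
    image_eq_zero_of_notMem_tsupport fun h => absurd (hR h) (by simpa using hx)
  have hε' : 0 < 1 / ε := by positivity
  have hG₁ : Integrable (Function.uncurry fun x z =>
      v x * (u x - u (x + z)) / ‖z‖ ^ ((N : ℝ) + 2 * s))
      (volume.prod (volume.restrict (annulus N ε))) := by
    refine integrable_prod_div_norm_rpow (G := fun q => v q.1 * (u q.1 - u (q.1 + q.2)))
      (R := R + 1 / ε) hε (by fun_prop) fun q h1 h2 => ?_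
    have h3 : ‖q.1‖ ≤ ‖q.1 + q.2‖ + ‖q.2‖ := by
      simpa using norm_sub_le (q.1 + q.2) q.2
    rw [hu0 q.1 (by linarith), hu0 (q.1 + q.2) (by linarith), sub_zero, mul_zero]
  have hG₂ : Integrable (Function.uncurry fun x z =>
      u x * (v x - v (x + z)) / ‖z‖ ^ ((N : ℝ) + 2 * s))
      (volume.prod (volume.restrict (annulus N ε))) := by
    refine integrable_prod_div_norm_rpow (G := fun q => u q.1 * (v q.1 - v (q.1 + q.2)))
      (R := R) hε (by fun_prop) fun q h1 _ => ?_
    rw [hu0 q.1 h1, zero_mul]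
  have hshift : ∀ z, ∫ x, v x * (u x - u (x + z)) = ∫ x, u x * (v x - v (x + -z)) := by
    intro z
    have i0 : Integrable fun x => v x * u x :=
      (hv.mul hu).integrable_of_hasCompactSupport hcu.mul_left
    have i1 : Integrable fun x => v x * u (x + z) :=
      (hv.mul (hu.comp (continuous_add_const z))).integrable_of_hasCompactSupport
        (hcu.comp_homeomorph (Homeomorph.addRight z)).mul_left
    have i2 : Integrable fun x => u x * v (x + -z) :=
      (hu.mul (hv.comp (continuous_add_const (-z)))).integrable_of_hasCompactSupport hcu.mul_right
    simp only [mul_sub]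
    rw [integral_sub i0 i1, integral_sub (by simpa only [mul_comm] using i0) i2,
      ← integral_add_right_eq_self (fun x => v x * u (x + z)) (-z)]
    simp only [neg_add_cancel_right, mul_comm]
  calc ∫ x, v x * pvInt N s u x ε
      = ∫ x, ∫ z in annulus N ε, v x * (u x - u (x + z)) / ‖z‖ ^ ((N : ℝ) + 2 * s) := by
        simp only [pvInt, ← integral_const_mul, mul_div_assoc]
    _ = ∫ z in annulus N ε, ∫ x, v x * (u x - u (x + z)) / ‖z‖ ^ ((N : ℝ) + 2 * s) :=
        integral_integral_swap hG₁
    _ = ∫ z in annulus N ε, ∫ x, u x * (v x - v (x + -z)) / ‖-z‖ ^ ((N : ℝ) + 2 * s) := by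
        simp only [integral_div, hshift, norm_neg]
    _ = ∫ z in annulus N ε, ∫ x, u x * (v x - v (x + z)) / ‖z‖ ^ ((N : ℝ) + 2 * s) :=
        setIntegral_annulus_neg ε fun z =>
          ∫ x, u x * (v x - v (x + z)) / ‖z‖ ^ ((N : ℝ) + 2 * s)
    _ = ∫ x, ∫ z in annulus N ε, u x * (v x - v (x + z)) / ‖z‖ ^ ((N : ℝ) + 2 * s) :=
        (integral_integral_swap hG₂).symm
    _ = ∫ x, u x * pvInt N s v x ε := by
        simp only [pvInt, ← integral_const_mul, mul_div_assoc]

lemma aestronglyMeasurable_pvInt {N : ℕ} {s ε : ℝ} {u : EuclideanSpace ℝ (Fin N) → ℝ}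
    (hu : Continuous u) (μ : Measure (EuclideanSpace ℝ (Fin N))) :
    AEStronglyMeasurable (fun x => pvInt N s u x ε) μ := by
  have hmeas : Measurable fun q : EuclideanSpace ℝ (Fin N) × EuclideanSpace ℝ (Fin N) =>
      (u q.1 - u (q.1 + q.2)) / ‖q.2‖ ^ ((N : ℝ) + 2 * s) :=
    (by fun_prop : Continuous fun q : EuclideanSpace ℝ (Fin N) × EuclideanSpace ℝ (Fin N) =>
      u q.1 - u (q.1 + q.2)).measurable.div (measurable_snd.norm.pow_const _)
  exact hmeas.stronglyMeasurable.integral_prod_right'.aestronglyMeasurable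

lemma TestFun.eq_zero_of_nonpos {N : ℕ} [NeZero N] {s : ℝ} {ξ L : EuclideanSpace ℝ (Fin N) → ℝ}
    (h : TestFun N s ξ L) {x : EuclideanSpace ℝ (Fin N)} (hx : x 0 ≤ 0) : ξ x = 0 := by
  have hneg : ∀ y : EuclideanSpace ℝ (Fin N), y 0 < 0 → ξ y = 0 := fun y hy =>
    image_eq_zero_of_notMem_tsupport fun hmem => absurd (h.supp hmem) (not_le.2 hy)
  let e : EuclideanSpace ℝ (Fin N) := EuclideanSpace.single 0 1
  have hcont : Continuous fun t : ℝ => ξ (x - t • e) := h.cont.comp (by fun_prop)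
  have hlim : Tendsto (fun t : ℝ => ξ (x - t • e)) (𝓝[>] 0) (𝓝 (ξ x)) := by
    have := hcont.tendsto 0
    simp only [zero_smul, sub_zero] at this
    exact this.mono_left nhdsWithin_le_nhds
  refine tendsto_nhds_unique hlim (tendsto_const_nhds.congr' ?_)
  filter_upwards [self_mem_nhdsWithin] with t ht
  refine (hneg _ ?_).symm
  have ht0 : 0 < t := ht
  simp only [PiLp.sub_apply, PiLp.smul_apply, e, smul_eq_mul]
  simp
  linarith

lemma TestFun.exists_abs_le {N : ℕ} [NeZero N] {s : ℝ} {ξ L : EuclideanSpace ℝ (Fin N) → ℝ}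
    (h : TestFun N s ξ L) :
    ∃ C : ℝ, 0 ≤ C ∧ ∀ x : EuclideanSpace ℝ (Fin N), 0 < x 0 → |ξ x| ≤ C * (x 0) ^ s := by
  obtain ⟨g, hg, hgξ⟩ := h.quot
  obtain ⟨C, hC⟩ := h.cpt.isCompact.exists_bound_of_continuousOn (hg.mono h.supp)
  refine ⟨max C 0, le_max_right _ _, fun x hx => ?_⟩
  have hp : 0 < (x 0) ^ s := Real.rpow_pos_of_pos hx s
  by_cases hmem : x ∈ tsupport ξ
  · have hξ : ξ x = g x * (x 0) ^ s := by
      rw [hgξ x hx, Real.rpow_neg hx.le]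
      field_simp
    rw [hξ, abs_mul, abs_of_pos hp]
    exact mul_le_mul_of_nonneg_right ((hC x hmem).trans (le_max_left _ _)) hp.le
  · rw [image_eq_zero_of_notMem_tsupport hmem, abs_zero]
    exact mul_nonneg (le_max_right _ _) hp.le

lemma TestFun.tendsto_integral_mul_pvInt_Rs {N : ℕ} [NeZero N] {s : ℝ} (hs : s ∈ Ioo (0 : ℝ) 1)
    {ξ L : EuclideanSpace ℝ (Fin N) → ℝ} (h : TestFun N s ξ L) :
    Tendsto (fun ε => ∫ x, ξ x * pvInt N s (Rs N s) x ε) (𝓝[>] 0) (𝓝 0) := by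
  obtain ⟨C, hC0, hC⟩ := h.exists_abs_le
  let M : ℝ := C * ((∫ z, |secondDiffKernel N s z|) / 2)
  have hM : 0 ≤ M :=
    mul_nonneg hC0 (div_nonneg (integral_nonneg fun z => abs_nonneg _) zero_le_two)
  have hbound : Integrable ((tsupport ξ).indicator fun _ => M) :=
    (integrable_indicator_iff (isClosed_tsupport ξ).measurableSet).2
      (integrableOn_const h.cpt.isCompact.measure_lt_top.ne)
  rw [show 𝓝 (0 : ℝ) = 𝓝 (∫ _ : EuclideanSpace ℝ (Fin N), (0 : ℝ)) by simp]
  refine tendsto_integral_filter_of_dominated_convergence _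
    (.of_forall fun ε => h.cont.aestronglyMeasurable.mul
      (aestronglyMeasurable_pvInt (continuous_Rs hs.1) _)) ?_ hbound (.of_forall fun x => ?_)
  · filter_upwards [self_mem_nhdsWithin] with ε hε
    refine .of_forall fun x => ?_
    by_cases hmem : x ∈ tsupport ξ
    · rw [indicator_of_mem hmem]
      rcases le_or_gt (x 0) 0 with hx | hx
      · rwa [h.eq_zero_of_nonpos hx, zero_mul, norm_zero]
      · rw [norm_mul, Real.norm_eq_abs, Real.norm_eq_abs]
        calc |ξ x| * |pvInt N s (Rs N s) x ε|
            ≤ C * (x 0) ^ s * |pvInt N s (Rs N s) x ε| :=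
              mul_le_mul_of_nonneg_right (hC x hx) (abs_nonneg _)
          _ ≤ M := by
              rw [mul_assoc]
              exact mul_le_mul_of_nonneg_left (rpow_mul_abs_pvInt_Rs_le hs hε hx) hC0
    · rw [image_eq_zero_of_notMem_tsupport hmem, zero_mul, norm_zero, indicator_of_notMem hmem]
  · rcases le_or_gt (x 0) 0 with hx | hx
    · simp only [h.eq_zero_of_nonpos hx, zero_mul]
      exact tendsto_const_nhds
    · simpa using (tendsto_pvInt_Rs hs hx).const_mul (ξ x)

lemma TestFun.integral_rpow_mul_eq_zero {N : ℕ} [NeZero N] {s : ℝ} (hs : s ∈ Ioo (0 : ℝ) 1)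
    {ξ L : EuclideanSpace ℝ (Fin N) → ℝ} (h : TestFun N s ξ L) :
    ∫ x in {x : EuclideanSpace ℝ (Fin N) | 0 < x 0}, (x 0) ^ s * L x = 0 := by
  have hmeas : MeasurableSet {x : EuclideanSpace ℝ (Fin N) | 0 < x 0} :=
    measurableSet_lt measurable_const (measurable_coord 0)
  obtain ⟨φ, ε₀, hε₀, hφ, hdom⟩ := h.dom
  have hlim : Tendsto (fun ε => ∫ x in {x : EuclideanSpace ℝ (Fin N) | 0 < x 0},
      (x 0) ^ s * (cns N s * pvInt N s ξ x ε)) (𝓝[>] 0)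
      (𝓝 (∫ x in {x : EuclideanSpace ℝ (Fin N) | 0 < x 0}, (x 0) ^ s * L x)) := by
    refine tendsto_integral_filter_of_dominated_convergence _ (.of_forall fun ε => ?_) ?_ hφ ?_
    · exact ((measurable_coord 0).pow_const s).aestronglyMeasurable.mul
        ((aestronglyMeasurable_pvInt h.cont _).const_mul _)
    · filter_upwards [Ioc_mem_nhdsGT hε₀] with ε hε
      filter_upwards [ae_restrict_mem hmeas, ae_restrict_of_ae (hdom ε hε)] with x hx hle
      have hp : 0 ≤ (x 0) ^ s := Real.rpow_nonneg (le_of_lt hx) s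
      rw [norm_mul, Real.norm_of_nonneg hp, mul_comm, Real.norm_eq_abs]
      exact mul_le_mul_of_nonneg_right (hle hx) hp
    · filter_upwards [ae_restrict_mem hmeas] with x hx
      exact (h.pv x hx).const_mul _
  refine tendsto_nhds_unique hlim ?_
  have hzero := (h.tendsto_integral_mul_pvInt_Rs hs).const_mul (cns N s)
  rw [mul_zero] at hzero
  refine hzero.congr' ?_
  filter_upwards [self_mem_nhdsWithin] with ε hε
  rw [← integral_mul_pvInt_comm hε h.cont h.cpt (continuous_Rs hs.1), ← integral_const_mul,
    ← integral_indicator hmeas]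
  congr 1
  funext x
  by_cases hx : 0 < x 0
  · rw [indicator_of_mem (by exact hx), Rs, if_pos hx]
    ring
  · rw [indicator_of_notMem (by exact hx), Rs, if_neg hx]
    ring

/-- `ℛ_s(x) = (x₁)₊^s` is `s`-harmonic in the upper half-space, and
`∫_{ℝ^N_+} x₁^s (-Δ)^s φ dx = 0` for every `φ ∈ 𝕏_s(ℝ^N_+)`
(with `L = (-Δ)^s φ` on `ℝ^N_+`). -/
theorem Rs_sHarmonic_and_distributional
    (N : ℕ) [NeZero N] (hN : 2 ≤ N) (s : ℝ) (hs : s ∈ Ioo (0 : ℝ) 1) :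
    (∀ x : EuclideanSpace ℝ (Fin N), 0 < x 0 → SHarmonicAt N s (Rs N s) x) ∧
    (∀ φ L : EuclideanSpace ℝ (Fin N) → ℝ, TestFun N s φ L →
      ∫ x in {x : EuclideanSpace ℝ (Fin N) | 0 < x 0}, (x 0) ^ s * L x = 0) := by
  refine ⟨fun x hx => ?_, fun φ L h => h.integral_rpow_mul_eq_zero hs⟩
  simpa [SHarmonicAt] using (tendsto_pvInt_Rs hs hx).const_mul (cns N s)
end
end
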